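/- arXiv:2011.00358 — 4 statements merged into one kernel-verified Lean document; each statement's English description precedes it below -/
import Mathlib

section
/- Let n ≥ 2. Suppose w : ℝ^{n−1} × ℝ → ℝ is a bounded C² function, f : ℝ^{n−1} → ℝ is a bounded continuous function, and for every (y,z) ∈ ℝ^{n−1} × ℝ one has Δ_{ℝ^{n−1}} w(y,z) + ∂_z² w(y,z) − W''(ℍ(z)) w(y,z) = f(y) ℍ'(z). Then there exists a C² function c : ℝ^{n−1} → ℝ such that w(y,z) = c(y) ℍ'(z) for all (y,z), and moreover Δ_{ℝ^{n−1}} c = f. -/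
open MeasureTheory Filter

/-- The Euclidean Laplacian of a function on `ℝ^k` (as `Fin k → ℝ`): the sum of the
second partial derivatives in the coordinate directions. -/
noncomputable def lapPi {k : ℕ} (c : (Fin k → ℝ) → ℝ) (y : Fin k → ℝ) : ℝ :=
  ∑ i, iteratedDeriv 2 (fun t => c (Function.update y i t)) (y i)

lemma IsLocalMax.iteratedDeriv_two_nonpos {f : ℝ → ℝ} {x : ℝ} (h : IsLocalMax f x)
    (hc : ContinuousAt f x) : iteratedDeriv 2 f x ≤ 0 := by
  by_contra! hpos
  rw [iteratedDeriv_succ, iteratedDeriv_one] at hpos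
  have hmin := isLocalMin_of_deriv_deriv_pos hpos h.deriv_eq_zero hc
  have hconst : f =ᶠ[nhds x] fun _ => f x := by
    filter_upwards [h, hmin] with t h1 h2 using le_antisymm h1 h2
  have h2 := hconst.deriv.deriv_eq
  simp at h2
  exact hpos.ne' h2

lemma contDiff_update_slice {k : ℕ} {c : (Fin k → ℝ) → ℝ} (hc : ContDiff ℝ 2 c)
    (y : Fin k → ℝ) (i : Fin k) : ContDiff ℝ 2 (fun t : ℝ => c (Function.update y i t)) :=
  hc.comp (contDiff_update 2 y i)

lemma lapPi_sub {k : ℕ} {c d : (Fin k → ℝ) → ℝ} (hc : ContDiff ℝ 2 c) (hd : ContDiff ℝ 2 d)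
    (y : Fin k → ℝ) : lapPi (fun y => c y - d y) y = lapPi c y - lapPi d y := by
  simp only [lapPi, ← Finset.sum_sub_distrib]
  refine Finset.sum_congr rfl fun i _ => ?_
  have h1 := contDiff_update_slice hc y i
  have h2 := contDiff_update_slice hd y i
  exact iteratedDeriv_fun_sub (n := 2) (x := y i) h1.contDiffAt h2.contDiffAt

lemma lapPi_const_mul {k : ℕ} (c : (Fin k → ℝ) → ℝ) (a : ℝ)
    (y : Fin k → ℝ) : lapPi (fun y => a * c y) y = a * lapPi c y := by
  simp only [lapPi, Finset.mul_sum]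
  refine Finset.sum_congr rfl fun i _ => ?_
  exact iteratedDeriv_const_mul_field a _

lemma lapPi_add_const_mul_sum_sq {k : ℕ} (a b : ℝ) (y : Fin k → ℝ) :
    lapPi (fun y => a + b * ∑ j, y j ^ 2) y = 2 * b * k := by
  have h (i : Fin k) : iteratedDeriv 2
      (fun t => a + b * ∑ j, Function.update y i t j ^ 2) (y i) = 2 * b := by
    have hs (t : ℝ) : a + b * ∑ j, Function.update y i t j ^ 2
        = b * t ^ 2 + (a + b * ∑ j ∈ Finset.univ.erase i, y j ^ 2) := by
      rw [← Finset.add_sum_erase _ _ (Finset.mem_univ i), Function.update_self,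
        Finset.sum_congr rfl fun j hj => by
          rw [Function.update_of_ne (Finset.ne_of_mem_erase hj)]]
      ring
    simp_rw [hs]
    have hd : deriv (fun t : ℝ => b * t ^ 2 + (a + b * ∑ j ∈ Finset.univ.erase i, y j ^ 2))
        = fun t => 2 * b * t := by
      funext t
      have := (((hasDerivAt_pow 2 t).const_mul b).add_const
        (a + b * ∑ j ∈ Finset.univ.erase i, y j ^ 2)).deriv
      rw [this]; push_cast; ring
    rw [iteratedDeriv_succ, iteratedDeriv_one, hd]
    simp
  simp only [lapPi, h, Finset.sum_const, Finset.card_univ, Fintype.card_fin, nsmul_eq_mul]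
  ring

/-- If a continuous function of `(y, z, z')` is positive somewhere on an open set `S` of pairs
`(z, z')`, is nonpositive on `C \ S` for some closed `C ⊇ S`, and its positivity set over `C` is
bounded, then it has a positive interior maximum, at which the first and second order conditions
hold along every coordinate direction. -/
lemma exists_interior_max {k : ℕ} {u : (Fin k → ℝ) → ℝ → ℝ → ℝ} {S C : Set (ℝ × ℝ)}
    (hu : Continuous fun p : (Fin k → ℝ) × ℝ × ℝ => u p.1 p.2.1 p.2.2)
    (hS : IsOpen S) (hC : IsClosed C) (hSC : S ⊆ C) {R : ℝ}
    (hbd : ∀ y z z', (z, z') ∈ C → 0 < u y z z' →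
      (z, z') ∈ S ∧ ‖y‖ ≤ R ∧ |z| ≤ R ∧ |z'| ≤ R)
    {y₀ : Fin k → ℝ} {z₀ z₀' : ℝ} (h₀ : (z₀, z₀') ∈ S) (hpos : 0 < u y₀ z₀ z₀') :
    ∃ y z z', (z, z') ∈ S ∧ lapPi (fun y => u y z z') y ≤ 0 ∧
      deriv (fun t => u y t z') z = 0 ∧ iteratedDeriv 2 (fun t => u y t z') z ≤ 0 ∧
      deriv (fun t => u y z t) z' = 0 ∧ iteratedDeriv 2 (fun t => u y z t) z' ≤ 0 := by
  set U : (Fin k → ℝ) × ℝ × ℝ → ℝ := fun p => u p.1 p.2.1 p.2.2 with hU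
  have hmemball : ∀ y z z', (z, z') ∈ C → 0 < u y z z' →
      (y, z, z') ∈ Metric.closedBall (0 : (Fin k → ℝ) × ℝ × ℝ) R := by
    intro y z z' h1 h2
    obtain ⟨-, hy, hz, hz'⟩ := hbd y z z' h1 h2
    simp [Prod.norm_def, hy, hz, hz']
  have hK : IsCompact (Metric.closedBall (0 : (Fin k → ℝ) × ℝ × ℝ) R ∩ (Prod.snd ⁻¹' C)) :=
    (isCompact_closedBall _ _).inter_right (hC.preimage continuous_snd)
  obtain ⟨⟨y, z, z'⟩, ⟨-, hpC⟩, hmax⟩ := hK.exists_isMaxOn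
    ⟨(y₀, z₀, z₀'), hmemball _ _ _ (hSC h₀) hpos, hSC h₀⟩ hu.continuousOn
  have hp : 0 < u y z z' :=
    hpos.trans_le (hmax ⟨hmemball _ _ _ (hSC h₀) hpos, hSC h₀⟩)
  have hpS := (hbd y z z' hpC hp).1
  have hloc : IsLocalMax U (y, z, z') := by
    have hopen : (Prod.snd ⁻¹' S : Set ((Fin k → ℝ) × ℝ × ℝ)) ∈ nhds (y, z, z') :=
      (hS.preimage continuous_snd).mem_nhds hpS
    filter_upwards [hopen] with ⟨a, b, c⟩ hq
    by_cases h : 0 < u a b c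
    · exact hmax ⟨hmemball _ _ _ (hSC hq) h, hSC hq⟩
    · exact (not_lt.mp h).trans hp.le
  have slice : ∀ (γ : ℝ → (Fin k → ℝ) × ℝ × ℝ) (t : ℝ), Continuous γ → γ t = (y, z, z') →
      IsLocalMax (fun s => U (γ s)) t ∧ ContinuousAt (fun s => U (γ s)) t := by
    intro γ t hγ ht
    refine ⟨?_, (hu.comp hγ).continuousAt⟩
    have := hγ.tendsto t
    rw [ht] at this
    filter_upwards [this.eventually hloc] with s hs
    simpa only [ht] using hs
  refine ⟨y, z, z', hpS, Finset.sum_nonpos fun i _ => ?_, ?_, ?_, ?_, ?_⟩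
  · obtain ⟨h1, h2⟩ := slice (fun t => (Function.update y i t, z, z')) (y i)
      (by fun_prop) (by simp)
    exact h1.iteratedDeriv_two_nonpos h2
  · exact (slice (fun t => (y, t, z')) z (by fun_prop) rfl).1.deriv_eq_zero
  · obtain ⟨h1, h2⟩ := slice (fun t => (y, t, z')) z (by fun_prop) rfl
    exact h1.iteratedDeriv_two_nonpos h2
  · exact (slice (fun t => (y, z, t)) z' (by fun_prop) rfl).1.deriv_eq_zero
  · obtain ⟨h1, h2⟩ := slice (fun t => (y, z, t)) z' (by fun_prop) rfl
    exact h1.iteratedDeriv_two_nonpos h2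

lemma iteratedDeriv_two_eq {f f₁ : ℝ → ℝ} {x c : ℝ} (h : ∀ t, HasDerivAt f (f₁ t) t)
    (h' : HasDerivAt f₁ c x) : iteratedDeriv 2 f x = c := by
  rw [iteratedDeriv_succ, iteratedDeriv_one, funext fun t => (h t).deriv, h'.deriv]

lemma ContDiff.hasDerivAt_deriv_two {f : ℝ → ℝ} (h : ContDiff ℝ 2 f) (x : ℝ) :
    HasDerivAt (deriv f) (iteratedDeriv 2 f x) x := by
  rw [iteratedDeriv_succ, iteratedDeriv_one]
  exact ((h.iterate_deriv' 1 1).differentiable (by norm_num) x).hasDerivAt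

lemma ContDiff.hasDerivAt_of_two {f : ℝ → ℝ} (h : ContDiff ℝ 2 f) (x : ℝ) :
    HasDerivAt f (deriv f x) x :=
  (h.differentiable (by norm_num) x).hasDerivAt

lemma monotoneOn_of_hasDerivAt {D : Set ℝ} (hD : Convex ℝ D) {f f' : ℝ → ℝ}
    (h : ∀ t, HasDerivAt f (f' t) t) (h0 : ∀ t ∈ D, 0 ≤ f' t) : MonotoneOn f D :=
  monotoneOn_of_hasDerivWithinAt_nonneg hD (fun t _ => (h t).continuousAt.continuousWithinAt)
    (fun t _ => (h t).hasDerivWithinAt) fun t ht => h0 t (interior_subset ht)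

lemma norm_le_sqrt_of_sum_sq_le {k : ℕ} {y : Fin k → ℝ} {r : ℝ} (h : ∑ j, y j ^ 2 ≤ r) :
    ‖y‖ ≤ √r := by
  refine (pi_norm_le_iff_of_nonneg (Real.sqrt_nonneg _)).2 fun j => Real.abs_le_sqrt ?_
  exact (Finset.single_le_sum (f := fun j => y j ^ 2) (fun i _ => sq_nonneg _)
    (Finset.mem_univ j)).trans h

/-- A bounded function with bounded Laplacian satisfies a one-sided Lipschitz bound in the last
variable. -/
lemma sub_le_mul_sub_of_abs_laplacian_le {k : ℕ} {w : (Fin k → ℝ) → ℝ → ℝ}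
    (hw : ContDiff ℝ 2 fun p : (Fin k → ℝ) × ℝ => w p.1 p.2) {M F : ℝ}
    (hM : ∀ y z, |w y z| ≤ M)
    (hF : ∀ y z, |lapPi (fun y' => w y' z) y + iteratedDeriv 2 (w y) z| ≤ F) :
    ∀ y z z', 0 < z - z' → w y z - w y z' ≤ (2 * M + (F + 1)) * (z - z') := by
  have hM0 : 0 ≤ M := (abs_nonneg _).trans (hM 0 0)
  have hF0 : 0 ≤ F := (abs_nonneg _).trans (hF 0 0)
  set B : ℝ := F + 1 with hB
  set A : ℝ := 2 * M + B with hA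
  have hslice : ∀ y, ContDiff ℝ 2 (w y) := fun y => hw.comp (contDiff_prodMk_right y)
  have hslice' : ∀ z, ContDiff ℝ 2 fun y => w y z := fun z => hw.comp (contDiff_prodMk_left z)
  have hdiff : ∀ y z z', |w y z - w y z'| ≤ 2 * M := fun y z z' => by
    have h1 := abs_le.1 (hM y z)
    have h2 := abs_le.1 (hM y z')
    exact abs_le.2 ⟨by linarith, by linarith⟩
  have key : ∀ η : ℝ, 0 < η → η * (2 * k + 2) ≤ 1 → ∀ y z z', 0 < z - z' → z - z' < 1 →
      (w y z - w y z') - ((A * (z - z') - B * (z - z') ^ 2) + η * z ^ 2 + η * ∑ j, y j ^ 2)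
        ≤ 0 := by
    intro η hη hηk y₀ z₀ z₀' h0 h1
    by_contra! hpos
    have hcont : Continuous fun p : (Fin k → ℝ) × ℝ × ℝ => (w p.1 p.2.1 - w p.1 p.2.2)
        - ((A * (p.2.1 - p.2.2) - B * (p.2.1 - p.2.2) ^ 2) + η * p.2.1 ^ 2
          + η * ∑ j, p.1 j ^ 2) := by
      have c1 : Continuous fun p : (Fin k → ℝ) × ℝ × ℝ => w p.1 p.2.1 :=
        hw.continuous.comp (by fun_prop : Continuous fun p : (Fin k → ℝ) × ℝ × ℝ => (p.1, p.2.1))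
      have c2 : Continuous fun p : (Fin k → ℝ) × ℝ × ℝ => w p.1 p.2.2 :=
        hw.continuous.comp (by fun_prop : Continuous fun p : (Fin k → ℝ) × ℝ × ℝ => (p.1, p.2.2))
      fun_prop
    obtain ⟨y, z, z', ⟨hzz, hzz1⟩, hy, -, hz, -, hz'⟩ := exists_interior_max
      (u := fun y z z' => (w y z - w y z')
        - ((A * (z - z') - B * (z - z') ^ 2) + η * z ^ 2 + η * ∑ j, y j ^ 2))
      (S := {p | 0 < p.1 - p.2 ∧ p.1 - p.2 < 1}) (C := {p | 0 ≤ p.1 - p.2 ∧ p.1 - p.2 ≤ 1})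
      hcont
      (isOpen_Ioo.preimage (continuous_fst.sub continuous_snd))
      (isClosed_Icc.preimage (continuous_fst.sub continuous_snd))
      (fun p hp => ⟨hp.1.le, hp.2.le⟩) (R := √(2 * M / η) + 1)
      (by
        rintro y z z' ⟨h0, h1⟩ hu
        simp only [Set.mem_ofPred_eq] at h0 h1 ⊢
        have hN : 0 ≤ ∑ j, y j ^ 2 := Finset.sum_nonneg fun _ _ => sq_nonneg _
        have hω : 2 * M * (z - z') ≤ A * (z - z') - B * (z - z') ^ 2 := by
          have hB0 : 0 ≤ B := by positivity
          nlinarith [mul_nonneg hB0 (mul_nonneg h0 (sub_nonneg.2 h1))]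
        have hω0 : 0 ≤ 2 * M * (z - z') := by positivity
        have hd := (abs_le.1 (hdiff y z z')).2
        have hlt : ∑ j, y j ^ 2 + z ^ 2 ≤ 2 * M / η := by
          rw [le_div_iff₀ hη]; nlinarith
        have hzR : |z| ≤ √(2 * M / η) := Real.abs_le_sqrt (by linarith)
        refine ⟨⟨lt_of_le_of_ne h0 ?_, lt_of_le_of_ne h1 ?_⟩, ?_, by linarith, ?_⟩
        · intro h
          obtain rfl : z = z' := by linarith
          have : 0 ≤ η * z ^ 2 + η * ∑ j, y j ^ 2 := by positivity
          simp at hu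
          linarith
        · intro h
          have : 0 ≤ η * z ^ 2 + η * ∑ j, y j ^ 2 := by positivity
          rw [h] at hu hω
          linarith
        · linarith [norm_le_sqrt_of_sum_sq_le (y := y) (r := 2 * M / η) (by nlinarith)]
        · rw [abs_le] at hzR ⊢
          constructor <;> linarith [hzR.1, hzR.2])
      (y₀ := y₀) (z₀ := z₀) (z₀' := z₀') ⟨h0, h1⟩ hpos
    rw [lapPi_sub ((hslice' z).sub (hslice' z')) (by fun_prop), lapPi_sub (hslice' z) (hslice' z'),
      lapPi_add_const_mul_sum_sq] at hy
    have hz2 : iteratedDeriv 2 (fun t => (w y t - w y z')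
        - ((A * (t - z') - B * (t - z') ^ 2) + η * t ^ 2 + η * ∑ j, y j ^ 2)) z
        = iteratedDeriv 2 (w y) z - (-2 * B + 2 * η) := by
      refine iteratedDeriv_two_eq (f₁ := fun t => deriv (w y) t
        - (A - 2 * B * (t - z') + 2 * η * t)) (fun t => ?_) ?_
      · have h1 := (hasDerivAt_id t).sub_const z'
        refine HasDerivAt.congr_deriv ((((hslice y).hasDerivAt_of_two t).sub_const (w y z')).sub
          ((((h1.const_mul A).sub ((h1.pow 2).const_mul B)).add
            (((hasDerivAt_id t).pow 2).const_mul η)).add_const (η * ∑ j, y j ^ 2))) ?_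
        simp; ring
      · have h1 := (hasDerivAt_id z).sub_const z'
        refine HasDerivAt.congr_deriv (((hslice y).hasDerivAt_deriv_two z).sub
          (((h1.const_mul (2 * B)).const_sub A).add ((hasDerivAt_id z).const_mul (2 * η)))) ?_
        simp
    have hz2' : iteratedDeriv 2 (fun t => (w y z - w y t)
        - ((A * (z - t) - B * (z - t) ^ 2) + η * z ^ 2 + η * ∑ j, y j ^ 2)) z'
        = -iteratedDeriv 2 (w y) z' + 2 * B := by
      refine iteratedDeriv_two_eq (f₁ := fun t => -deriv (w y) t
        + (A - 2 * B * (z - t))) (fun t => ?_) ?_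
      · have h1 := (hasDerivAt_id t).const_sub z
        refine HasDerivAt.congr_deriv ((((hslice y).hasDerivAt_of_two t).const_sub (w y z)).sub
          ((((h1.const_mul A).sub ((h1.pow 2).const_mul B)).add_const
            (η * z ^ 2)).add_const (η * ∑ j, y j ^ 2))) ?_
        simp; ring
      · have h1 := (hasDerivAt_id z').const_sub z
        refine HasDerivAt.congr_deriv (((hslice y).hasDerivAt_deriv_two z').neg.add
          ((h1.const_mul (2 * B)).const_sub A)) ?_
        simp
    rw [hz2] at hz
    rw [hz2'] at hz'
    have e1 := (abs_le.1 (hF y z)).1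
    have e2 := (abs_le.1 (hF y z')).2
    linarith
  intro y z z' h0
  rcases lt_or_ge (z - z') 1 with h1 | h1
  · refine le_of_forall_pos_le_add fun e he => ?_
    have hN : 0 ≤ ∑ j, y j ^ 2 := Finset.sum_nonneg fun _ _ => sq_nonneg _
    set T : ℝ := z ^ 2 + ∑ j, y j ^ 2 with hT
    have hT0 : 0 ≤ T := by positivity
    have hk : (0 : ℝ) < 2 * k + 2 := by positivity
    set η : ℝ := min (1 / (2 * k + 2)) (e / (T + 1)) with hη
    have hη0 : 0 < η := by positivity
    have h2 : η * (2 * k + 2) ≤ 1 := by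
      rw [← le_div_iff₀ hk]; exact min_le_left _ _
    have h3 : η * (T + 1) ≤ e := by
      rw [← le_div_iff₀ (by positivity)]; exact min_le_right _ _
    have := key η hη0 h2 y z z' h0 h1
    have hBs : 0 ≤ B * (z - z') ^ 2 := by positivity
    have : η * T = η * z ^ 2 + η * ∑ j, y j ^ 2 := by rw [hT]; ring
    nlinarith
  · have hd := (abs_le.1 (hdiff y z z')).2
    nlinarith

lemma lapPi_neg {k : ℕ} (c : (Fin k → ℝ) → ℝ) (y : Fin k → ℝ) :
    lapPi (fun y => -c y) y = -lapPi c y := by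
  simpa using lapPi_const_mul c (-1) y

lemma iteratedDeriv_two_fun_neg (f : ℝ → ℝ) (x : ℝ) :
    iteratedDeriv 2 (fun t => -f t) x = -iteratedDeriv 2 f x := by
  simp

lemma abs_deriv_snd_le_of_abs_laplacian_le {k : ℕ} {w : (Fin k → ℝ) → ℝ → ℝ}
    (hw : ContDiff ℝ 2 fun p : (Fin k → ℝ) × ℝ => w p.1 p.2) {M F : ℝ}
    (hM : ∀ y z, |w y z| ≤ M)
    (hF : ∀ y z, |lapPi (fun y' => w y' z) y + iteratedDeriv 2 (w y) z| ≤ F)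
    (y : Fin k → ℝ) (z : ℝ) : |deriv (w y) z| ≤ 2 * M + (F + 1) := by
  have h1 := sub_le_mul_sub_of_abs_laplacian_le hw hM hF y
  have h2 := sub_le_mul_sub_of_abs_laplacian_le (w := fun y z => -w y z) hw.neg
    (by simpa using hM) (fun y z => by
      rw [lapPi_neg, iteratedDeriv_two_fun_neg, ← neg_add, abs_neg]
      exact hF y z) y
  have hM0 : 0 ≤ M := (abs_nonneg _).trans (hM 0 0)
  have hF0 : 0 ≤ F := (abs_nonneg _).trans (hF 0 0)
  set A : ℝ := 2 * M + (F + 1) with hA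
  have hA0 : 0 ≤ A := by positivity
  have hlt : ∀ a b, b < a → |w y a - w y b| ≤ A * |a - b| := fun a b h => by
    rw [abs_of_pos (sub_pos.2 h)]
    exact abs_le.2 ⟨by linarith [h2 a b (sub_pos.2 h)], h1 a b (sub_pos.2 h)⟩
  have hlip : LipschitzWith A.toNNReal (w y) := LipschitzWith.of_dist_le_mul fun a b => by
    rw [Real.dist_eq, Real.dist_eq, Real.coe_toNNReal A hA0]
    rcases lt_trichotomy a b with h | rfl | h
    · rw [abs_sub_comm, abs_sub_comm a]; exact hlt b a h
    · simp
    · exact hlt a b h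
  simpa [Real.coe_toNNReal A hA0] using norm_deriv_le_of_lipschitz hlip (x₀ := z)

/-- A function whose derivative is at least `1` outside a compact interval satisfies
`E z' ≤ E z` for `z' < z` unless `(z, z')` is in a fixed compact set. -/
lemma exists_bound_of_lt_of_deriv_ge {E E' : ℝ → ℝ} (hE : ∀ t, HasDerivAt E (E' t) t) {R₀ : ℝ}
    (hE' : ∀ t, R₀ ≤ |t| → 1 ≤ E' t) :
    ∃ R, ∀ z z', z' < z → E z < E z' → |z| ≤ R ∧ |z'| ≤ R := by
  wlog hR : 0 ≤ R₀ generalizing R₀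
  · exact this (R₀ := 0) (fun t _ => hE' t ((not_le.1 hR).le.trans (abs_nonneg t))) le_rfl
  have hc : Continuous E := continuous_iff_continuousAt.2 fun t => (hE t).continuousAt
  obtain ⟨K, hK⟩ := (isCompact_Icc (a := -R₀) (b := R₀)).exists_bound_of_continuousOn
    hc.continuousOn
  have hd : ∀ t, HasDerivAt (fun t => E t - t) (E' t - 1) t := fun t =>
    (hE t).sub (hasDerivAt_id t)
  have hup : MonotoneOn (fun t => E t - t) (Set.Ici R₀) :=
    monotoneOn_of_hasDerivAt (convex_Ici _) hd fun t ht =>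
      sub_nonneg.2 (hE' t (ht.trans (le_abs_self t)))
  have hdown : MonotoneOn (fun t => E t - t) (Set.Iic (-R₀)) :=
    monotoneOn_of_hasDerivAt (convex_Iic _) hd fun t ht =>
      sub_nonneg.2 (hE' t ((le_neg.1 ht).trans (neg_le_abs t)))
  have hmid : ∀ t, -R₀ ≤ t → t ≤ R₀ → -K ≤ E t ∧ E t ≤ K := fun t h1 h2 =>
    abs_le.1 (hK t ⟨h1, h2⟩)
  have hK0 : 0 ≤ K := by
    have := hmid 0 (by linarith) hR
    linarith
  have hhi : ∀ t, R₀ ≤ t → t - R₀ - K ≤ E t := fun t ht => by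
    have h1 := hup (Set.mem_Ici.2 le_rfl) (Set.mem_Ici.2 ht) ht
    have h2 := hmid R₀ (by linarith) le_rfl
    simp only at h1
    linarith
  have hlo : ∀ t, t ≤ -R₀ → E t ≤ t + R₀ + K := fun t ht => by
    have h1 := hdown (Set.mem_Iic.2 ht) (Set.mem_Iic.2 le_rfl) ht
    have h2 := hmid (-R₀) le_rfl (by linarith)
    simp only at h1
    linarith
  refine ⟨R₀ + 2 * K, fun z z' hlt hEE => ?_⟩
  have hz1 : z ≤ R₀ + 2 * K := by
    by_contra! h
    have hz := hhi z (by linarith)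
    rcases le_total R₀ z' with h1 | h1
    · have := hup (Set.mem_Ici.2 h1) (Set.mem_Ici.2 (h1.trans hlt.le)) hlt.le
      simp only at this
      linarith
    rcases le_total (-R₀) z' with h2 | h2
    · linarith [hmid z' h2 h1]
    · linarith [hlo z' h2]
  have hz2 : -(R₀ + 2 * K) ≤ z' := by
    by_contra! h
    have hz := hlo z' (by linarith)
    rcases le_total z (-R₀) with h1 | h1
    · have := hdown (Set.mem_Iic.2 (hlt.le.trans h1)) (Set.mem_Iic.2 h1) hlt.le
      simp only at this
      linarith
    rcases le_total z R₀ with h2 | h2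
    · linarith [hmid z h1 h2]
    · linarith [hhi z h2]
  exact ⟨abs_le.2 ⟨by linarith, hz1⟩, abs_le.2 ⟨hz2, by linarith⟩⟩

lemma exists_pos_mul_le {b v : ℝ → ℝ} (hb : Continuous b) (hv : Continuous v)
    (hb0 : ∀ z, 0 < b z) (hv0 : ∀ z, 0 < v z) {R : ℝ} (h : ∀ z, R ≤ |z| → b z ≤ v z) :
    ∃ c > 0, ∀ z, c * b z ≤ v z := by
  have hcont : Continuous fun z => v z / b z := hv.div hb fun z => (hb0 z).ne'
  obtain ⟨x, hx, hmin⟩ := (isCompact_Icc (a := -|R|) (b := |R|)).exists_isMinOn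
    ⟨0, by simp⟩ hcont.continuousOn
  refine ⟨min 1 (v x / b x), lt_min one_pos (div_pos (hv0 x) (hb0 x)), fun z => ?_⟩
  rcases le_total R |z| with hz | hz
  · exact (mul_le_of_le_one_left (hb0 z).le (min_le_left _ _)).trans (h z hz)
  · rw [← le_div_iff₀ (hb0 z)]
    exact (min_le_right _ _).trans (hmin (abs_le.1 (hz.trans (le_abs_self R))))

lemma le_of_weighted_equation {k : ℕ} {ψ : (Fin k → ℝ) → ℝ → ℝ}
    (hψ : ContDiff ℝ 2 fun p : (Fin k → ℝ) × ℝ => ψ p.1 p.2) {f : (Fin k → ℝ) → ℝ} {m : ℝ → ℝ}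
    (hpde : ∀ y z, lapPi (fun y' => ψ y' z) y + iteratedDeriv 2 (ψ y) z
      + 2 * m z * deriv (ψ y) z = f y)
    {b : ℝ → ℝ} (hb : Continuous b) (hb1 : ∀ z, 1 ≤ b z) (hψb : ∀ y z, |deriv (ψ y) z| ≤ b z)
    {v v₁ r₁ : ℝ → ℝ} (hv0 : ∀ z, 0 < v z) (hv : ∀ z, HasDerivAt v (v₁ z) z)
    (hr : ∀ z, HasDerivAt (fun z => v₁ z + 2 * m z * v z) (r₁ z) z) {δ : ℝ} (hδ : 0 < δ)
    (hrv : ∀ z, r₁ z ≤ -δ * v z) (hvb : ∀ N : ℝ, ∃ R, ∀ z, R ≤ |z| → N * b z ≤ v z)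
    (y : Fin k → ℝ) {z z' : ℝ} (hzz : z' < z) : ψ y z ≤ ψ y z' := by
  have hslice : ∀ y, ContDiff ℝ 2 (ψ y) := fun y => hψ.comp (contDiff_prodMk_right y)
  have hslice' : ∀ z, ContDiff ℝ 2 fun y => ψ y z := fun z => hψ.comp (contDiff_prodMk_left z)
  have hvc : Continuous v := continuous_iff_continuousAt.2 fun t => (hv t).continuousAt
  have hb0 : ∀ z, 0 < b z := fun z => one_pos.trans_le (hb1 z)
  obtain ⟨R₁, hR₁⟩ := hvb 1
  obtain ⟨c₀, hc₀, hcv⟩ := exists_pos_mul_le hb hvc hb0 hv0 (R := R₁) (by simpa using hR₁)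
  set g : ℝ → ℝ := fun z => ∫ t in (0 : ℝ)..z, v t with hg
  set B : ℝ → ℝ := fun z => ∫ t in (0 : ℝ)..z, b t with hB
  have hgd : ∀ z, HasDerivAt g (v z) z := fun z => (hvc.integral_hasStrictDerivAt 0 z).hasDerivAt
  have hBd : ∀ z, HasDerivAt B (b z) z := fun z => (hb.integral_hasStrictDerivAt 0 z).hasDerivAt
  have mono : ∀ {h h' : ℝ → ℝ}, (∀ t, HasDerivAt h (h' t) t) → (∀ t, 0 ≤ h' t) →
      ∀ {s t}, s ≤ t → h s ≤ h t := fun h1 h2 s t hst =>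
    monotoneOn_of_hasDerivAt convex_univ h1 (fun t _ => h2 t) trivial trivial hst
  have hgB : ∀ {s t}, s ≤ t → c₀ * (B t - B s) ≤ g t - g s := fun {s t} hst => by
    have := mono (fun t => (hgd t).sub ((hBd t).const_mul c₀)) (fun t => sub_nonneg.2 (hcv t)) hst
    simp only [Pi.sub_apply] at this
    linarith
  have hψB : ∀ y {s t}, s ≤ t → ψ y t - ψ y s ≤ B t - B s := fun y {s t} hst => by
    have := mono (fun t => (hBd t).sub ((hslice y).hasDerivAt_of_two t))
      (fun t => sub_nonneg.2 ((le_abs_self _).trans (hψb y t))) hst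
    simp only [Pi.sub_apply] at this
    linarith
  have hrg : ∀ {s t}, s ≤ t →
      (v₁ t + 2 * m t * v t) - (v₁ s + 2 * m s * v s) ≤ -δ * (g t - g s) := fun {s t} hst => by
    have := mono (fun t => (((hgd t).const_mul (-δ)).sub (hr t)))
      (fun t => sub_nonneg.2 (hrv t)) hst
    simp only [Pi.sub_apply] at this
    linarith
  have hBpos : ∀ {s t}, s ≤ t → 0 ≤ B t - B s := fun hst =>
    sub_nonneg.2 (mono hBd (fun t => (hb0 t).le) hst)
  set ε : ℝ := δ / (2 * (k + 1)) with hε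
  have hε0 : 0 < ε := by positivity
  have hεk : 2 * ε * k < δ := by
    have : ε * (2 * (k + 1)) = δ := div_mul_cancel₀ _ (by positivity)
    nlinarith
  have key : ∀ η : ℝ, 0 < η → ∀ y z z', z' < z →
      (ψ y z - ψ y z') - (η * (g z - g z') + η * (g z - g z') * ε * ∑ j, y j ^ 2) ≤ 0 := by
    intro η hη y₀ z₀ z₀' h₀
    by_contra! hpos
    obtain ⟨R₂, hR₂⟩ := hvb (2 / η)
    obtain ⟨R, hR⟩ := exists_bound_of_lt_of_deriv_ge (R₀ := R₂)
      (fun t => ((hgd t).const_mul η).sub (hBd t)) (fun t ht => by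
        have h1 := mul_le_mul_of_nonneg_left (hR₂ t ht) hη.le
        rw [← mul_assoc, mul_div_cancel₀ _ hη.ne'] at h1
        linarith [hb1 t])
    have hgc : Continuous g := continuous_iff_continuousAt.2 fun t => (hgd t).continuousAt
    have hcont : Continuous fun p : (Fin k → ℝ) × ℝ × ℝ => (ψ p.1 p.2.1 - ψ p.1 p.2.2)
        - (η * (g p.2.1 - g p.2.2) + η * (g p.2.1 - g p.2.2) * ε * ∑ j, p.1 j ^ 2) := by
      have c1 : Continuous fun p : (Fin k → ℝ) × ℝ × ℝ => ψ p.1 p.2.1 :=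
        hψ.continuous.comp (by fun_prop : Continuous fun p : (Fin k → ℝ) × ℝ × ℝ => (p.1, p.2.1))
      have c2 : Continuous fun p : (Fin k → ℝ) × ℝ × ℝ => ψ p.1 p.2.2 :=
        hψ.continuous.comp (by fun_prop : Continuous fun p : (Fin k → ℝ) × ℝ × ℝ => (p.1, p.2.2))
      fun_prop
    obtain ⟨y, z, z', hzz, hy, hz1, hz2, hz1', hz2'⟩ := exists_interior_max
      (u := fun y z z' => (ψ y z - ψ y z')
        - (η * (g z - g z') + η * (g z - g z') * ε * ∑ j, y j ^ 2))
      (S := {p | p.2 < p.1}) (C := {p | p.2 ≤ p.1}) hcont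
      (isOpen_lt continuous_snd continuous_fst) (isClosed_le continuous_snd continuous_fst)
      (fun p hp => by simp only [Set.mem_ofPred_eq] at hp ⊢; exact hp.le) (R := max (√(1 / (η * c₀ * ε))) R)
      (by
        intro y z z' h hu
        simp only [Set.mem_ofPred_eq] at h ⊢
        have hN : 0 ≤ ∑ j, y j ^ 2 := Finset.sum_nonneg fun _ _ => sq_nonneg _
        have hne : z' ≠ z := by rintro rfl; simp at hu
        have hlt : z' < z := lt_of_le_of_ne h hne
        have h1 := hψB y h
        have h2 := hgB h
        have h3 := hBpos h
        have h4 : 0 ≤ g z - g z' := (mul_nonneg hc₀.le h3).trans h2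
        have h5 : 0 ≤ η * (g z - g z') * ε * ∑ j, y j ^ 2 := by positivity
        obtain ⟨hzR, hzR'⟩ := hR z z' hlt (by simp only [Pi.sub_apply]; linarith)
        refine ⟨hlt, le_max_of_le_left (norm_le_sqrt_of_sum_sq_le ?_),
          le_max_of_le_right hzR, le_max_of_le_right hzR'⟩
        have h6 : 0 ≤ η * (g z - g z') := by positivity
        have h7 : (B z - B z') * (η * c₀ * ε * ∑ j, y j ^ 2)
            ≤ η * (g z - g z') * ε * ∑ j, y j ^ 2 := by
          have := mul_le_mul_of_nonneg_left h2 (by positivity : 0 ≤ η * ε * ∑ j, y j ^ 2)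
          linarith
        have h8 : 0 < B z - B z' := lt_of_le_of_ne h3 fun h0 => by rw [← h0] at h1; linarith
        rw [le_div_iff₀' (by positivity)]
        by_contra! hcon
        nlinarith)
      (y₀ := y₀) (z₀ := z₀) (z₀' := z₀') h₀ hpos
    simp only [Set.mem_ofPred_eq] at hzz
    set P : ℝ := 1 + ε * ∑ j, y j ^ 2 with hP
    have hP1 : 1 ≤ P := by
      have : 0 ≤ ∑ j, y j ^ 2 := Finset.sum_nonneg fun _ _ => sq_nonneg _
      have : 0 ≤ ε * ∑ j, y j ^ 2 := by positivity
      linarith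
    rw [lapPi_sub ((hslice' z).sub (hslice' z')) (by fun_prop), lapPi_sub (hslice' z) (hslice' z'),
      lapPi_add_const_mul_sum_sq] at hy
    have hd : ∀ t, HasDerivAt (fun t => (ψ y t - ψ y z')
        - (η * (g t - g z') + η * (g t - g z') * ε * ∑ j, y j ^ 2))
        (deriv (ψ y) t - η * P * v t) t := fun t => by
      have h1 := ((hgd t).sub_const (g z')).const_mul η
      exact ((((hslice y).hasDerivAt_of_two t).sub_const _).sub
        (h1.add ((h1.mul_const ε).mul_const (∑ j, y j ^ 2)))).congr_deriv (by rw [hP]; ring)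
    have hd' : ∀ t, HasDerivAt (fun t => (ψ y z - ψ y t)
        - (η * (g z - g t) + η * (g z - g t) * ε * ∑ j, y j ^ 2))
        (-deriv (ψ y) t + η * P * v t) t := fun t => by
      have h1 := ((hgd t).const_sub (g z)).const_mul η
      exact ((((hslice y).hasDerivAt_of_two t).const_sub _).sub
        (h1.add ((h1.mul_const ε).mul_const (∑ j, y j ^ 2)))).congr_deriv (by rw [hP]; ring)
    rw [(hd z).deriv] at hz1
    rw [(hd' z').deriv] at hz1'
    rw [iteratedDeriv_two_eq hd (((hslice y).hasDerivAt_deriv_two z).sub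
      ((hv z).const_mul (η * P)))] at hz2
    rw [iteratedDeriv_two_eq hd' (((hslice y).hasDerivAt_deriv_two z').neg.add
      ((hv z').const_mul (η * P)))] at hz2'
    have e1 := hpde y z
    have e2 := hpde y z'
    rw [show deriv (ψ y) z = η * P * v z by linarith] at e1
    rw [show deriv (ψ y) z' = η * P * v z' by linarith] at e2
    have hG : 0 < g z - g z' := by
      have hsm : StrictMono g := strictMono_of_deriv_pos fun t => by
        rw [(hgd t).deriv]; exact hv0 t
      exact sub_pos.2 (hsm hzz)
    have hηP : 0 < η * P := by positivity
    have e3 := mul_le_mul_of_nonneg_left (hrg hzz.le) hηP.le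
    have e4 : η * (g z - g z') * (2 * ε * k) < η * (g z - g z') * δ :=
      mul_lt_mul_of_pos_left hεk (by positivity)
    have e5 : η * (g z - g z') * δ * 1 ≤ η * (g z - g z') * δ * P :=
      mul_le_mul_of_nonneg_left hP1 (by positivity)
    linarith
  set T : ℝ := (g z - g z') * (1 + ε * ∑ j, y j ^ 2) with hT
  refine le_of_forall_pos_le_add fun e he => ?_
  have hη : 0 < e / (|T| + 1) := by positivity
  have h1 := key _ hη y z z' hzz
  have h2 : e / (|T| + 1) * T ≤ e := by
    rw [div_mul_eq_mul_div, div_le_iff₀ (by positivity)]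
    nlinarith [le_abs_self T]
  rw [hT] at h2
  linarith

lemma eq_of_weighted_equation {k : ℕ} {ψ : (Fin k → ℝ) → ℝ → ℝ}
    (hψ : ContDiff ℝ 2 fun p : (Fin k → ℝ) × ℝ => ψ p.1 p.2) {f : (Fin k → ℝ) → ℝ} {m : ℝ → ℝ}
    (hpde : ∀ y z, lapPi (fun y' => ψ y' z) y + iteratedDeriv 2 (ψ y) z
      + 2 * m z * deriv (ψ y) z = f y)
    {b : ℝ → ℝ} (hb : Continuous b) (hb1 : ∀ z, 1 ≤ b z) (hψb : ∀ y z, |deriv (ψ y) z| ≤ b z)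
    {v v₁ r₁ : ℝ → ℝ} (hv0 : ∀ z, 0 < v z) (hv : ∀ z, HasDerivAt v (v₁ z) z)
    (hr : ∀ z, HasDerivAt (fun z => v₁ z + 2 * m z * v z) (r₁ z) z) {δ : ℝ} (hδ : 0 < δ)
    (hrv : ∀ z, r₁ z ≤ -δ * v z) (hvb : ∀ N : ℝ, ∃ R, ∀ z, R ≤ |z| → N * b z ≤ v z)
    (y : Fin k → ℝ) (z z' : ℝ) : ψ y z = ψ y z' := by
  have h : ∀ z z', z' < z → ψ y z = ψ y z' := fun z z' hzz => by
    refine le_antisymm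
      (le_of_weighted_equation hψ hpde hb hb1 hψb hv0 hv hr hδ hrv hvb y hzz) ?_
    refine neg_le_neg_iff.1 (le_of_weighted_equation (ψ := fun y z => -ψ y z) (f := fun y => -f y)
      hψ.neg (fun y z => ?_) hb hb1 (fun y z => ?_) hv0 hv hr hδ hrv hvb y hzz)
    · rw [lapPi_neg, iteratedDeriv_two_fun_neg, deriv.fun_neg, ← hpde y z]; ring
    · rw [deriv.fun_neg, abs_neg]; exact hψb y z
  rcases lt_trichotomy z z' with hlt | rfl | hlt
  · exact (h z' z hlt).symm
  · rfl
  · exact h z z' hlt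

lemma tendsto_deriv_zero_of_antitoneOn {H φ : ℝ → ℝ} (hH : ∀ z, HasDerivAt H (φ z) z) {l : ℝ}
    (hl : Tendsto H atTop (nhds l)) (hpos : ∀ z, 0 < φ z) (hanti : AntitoneOn φ (Set.Ici 0)) :
    Tendsto φ atTop (nhds 0) := by
  have hshift : Tendsto (fun z => H z - H (z - 1)) atTop (nhds 0) := by
    simpa [sub_eq_add_neg] using hl.sub (hl.comp (tendsto_atTop_add_const_right _ (-1 : ℝ) tendsto_id))
  refine tendsto_of_tendsto_of_tendsto_of_le_of_le' tendsto_const_nhds hshift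
    (Eventually.of_forall fun z => (hpos z).le) ?_
  filter_upwards [eventually_ge_atTop 1] with z hz
  obtain ⟨c, ⟨hc1, hc2⟩, hc⟩ := exists_hasDerivAt_eq_slope H φ (sub_one_lt z)
    (fun t _ => (hH t).continuousAt.continuousWithinAt) fun t _ => hH t
  rw [sub_sub_cancel, div_one] at hc
  rw [← hc]
  exact hanti (Set.mem_Ici.2 (by linarith)) (Set.mem_Ici.2 (by linarith)) hc2.le

/-- Bounds on `[0, ∞)` for a positive decaying solution of `φ'' = V φ`. -/
lemma half_line_bounds {H φ φ₁ V : ℝ → ℝ} (hH : ∀ z, HasDerivAt H (φ z) z)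
    (hφ : ∀ z, HasDerivAt φ (φ₁ z) z) (hφ₁ : ∀ z, HasDerivAt φ₁ (V z * φ z) z) {l : ℝ}
    (hl : Tendsto H atTop (nhds l)) (hpos : ∀ z, 0 < φ z) (hneg : ∀ z, 0 ≤ z → φ₁ z ≤ 0)
    (hlim : Tendsto φ₁ atTop (nhds 0)) {K a Z : ℝ} (hK : 0 ≤ K) (hZ : 0 ≤ Z)
    (hVK : ∀ z, V z ≤ K ^ 2) (hVa : ∀ z, Z ≤ z → a ^ 2 ≤ V z) :
    (∀ z, 0 ≤ z → |φ₁ z| ≤ K * φ z) ∧ (∀ z, Z ≤ z → a * φ z ≤ |φ₁ z|) ∧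
      ∀ z, Z ≤ z → φ z ≤ φ Z * Real.exp (a * Z) * Real.exp (-(a * z)) := by
  have hanti : AntitoneOn φ (Set.Ici 0) := by
    have := monotoneOn_of_hasDerivAt (convex_Ici 0) (fun t => (hφ t).neg)
      fun t ht => neg_nonneg.2 (hneg t ht)
    exact fun s hs t ht hst => neg_le_neg_iff.1 (this hs ht hst)
  have hφlim := tendsto_deriv_zero_of_antitoneOn hH hl hpos hanti
  have hE : ∀ c t, HasDerivAt (fun z => φ₁ z ^ 2 - c ^ 2 * φ z ^ 2)
      (2 * (-φ₁ t * φ t) * (c ^ 2 - V t)) t := fun c t =>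
    (((hφ₁ t).pow 2).sub (((hφ t).pow 2).const_mul (c ^ 2))).congr_deriv (by simp; ring)
  have hElim : ∀ c : ℝ, Tendsto (fun z => φ₁ z ^ 2 - c ^ 2 * φ z ^ 2) atTop (nhds 0) := fun c => by
    simpa using (hlim.pow 2).sub ((hφlim.pow 2).const_mul (c ^ 2))
  have hnn : ∀ t, 0 ≤ t → 0 ≤ 2 * (-φ₁ t * φ t) := fun t ht =>
    mul_nonneg zero_le_two (mul_nonneg (neg_nonneg.2 (hneg t ht)) (hpos t).le)
  have hupper : ∀ z, 0 ≤ z → |φ₁ z| ≤ K * φ z := fun z hz => by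
    have hm := monotoneOn_of_hasDerivAt (convex_Ici 0) (hE K)
      fun t ht => mul_nonneg (hnn t ht) (sub_nonneg.2 (hVK t))
    have h0 : φ₁ z ^ 2 - K ^ 2 * φ z ^ 2 ≤ 0 := ge_of_tendsto (hElim K) <| by
      filter_upwards [eventually_ge_atTop z] with t ht
      exact hm (Set.mem_Ici.2 hz) (Set.mem_Ici.2 (hz.trans ht)) ht
    exact abs_le_of_sq_le_sq (by rw [mul_pow]; linarith) (mul_nonneg hK (hpos z).le)
  have hlower : ∀ z, Z ≤ z → a * φ z ≤ |φ₁ z| := fun z hz => by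
    have hm := monotoneOn_of_hasDerivAt (convex_Ici Z) (fun t => (hE a t).neg)
      fun t ht => by
        have := mul_nonneg (hnn t (hZ.trans ht)) (sub_nonneg.2 (hVa t ht))
        linarith
    have h0 : 0 ≤ φ₁ z ^ 2 - a ^ 2 * φ z ^ 2 := le_of_tendsto (hElim a) <| by
      filter_upwards [eventually_ge_atTop z] with t ht
      exact neg_le_neg_iff.1 (hm (Set.mem_Ici.2 hz) (Set.mem_Ici.2 (hz.trans ht)) ht)
    exact le_abs_self (a * φ z) |>.trans (sq_le_sq.1 (by rw [mul_pow]; linarith))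
  refine ⟨hupper, hlower, fun z hz => ?_⟩
  have hm := monotoneOn_of_hasDerivAt (convex_Ici Z)
    (f := fun t => -(φ t * Real.exp (a * t)))
    (f' := fun t => (-φ₁ t - a * φ t) * Real.exp (a * t))
    (fun t => ((hφ t).mul (((hasDerivAt_id t).const_mul a).exp)).neg.congr_deriv (by simp; ring))
    (fun t ht => by
      have h1 := hlower t ht
      rw [abs_of_nonpos (hneg t (hZ.trans ht))] at h1
      exact mul_nonneg (by linarith) (Real.exp_pos _).le)
  have h1 : φ z * Real.exp (a * z) ≤ φ Z * Real.exp (a * Z) :=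
    neg_le_neg_iff.1 (hm (Set.mem_Ici.2 le_rfl) (Set.mem_Ici.2 hz) hz)
  rw [Real.exp_neg, ← div_eq_mul_inv, le_div_iff₀ (Real.exp_pos _)]
  exact h1

lemma exists_weight {φ φ₁ : ℝ → ℝ} (hφ : ∀ z, HasDerivAt φ (φ₁ z) z) (hpos : ∀ z, 0 < φ z)
    (hsign : ∀ z, z * φ₁ z ≤ 0) {a Z C : ℝ} (ha : 0 < a)
    (hfar : ∀ z, Z ≤ |z| → a * φ z ≤ |φ₁ z|)
    (hdecay : ∀ z, Z ≤ |z| → φ z ≤ C * Real.exp (-(a * |z|))) :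
    ∃ v v₁ r₁ : ℝ → ℝ, ∃ δ > 0, (∀ z, 0 < v z) ∧ (∀ z, HasDerivAt v (v₁ z) z) ∧
      (∀ z, HasDerivAt (fun z => v₁ z + 2 * (φ₁ z / φ z) * v z) (r₁ z) z) ∧
      (∀ z, r₁ z ≤ -δ * v z) ∧ ∀ N : ℝ, ∃ R, ∀ z, R ≤ |z| → N * (φ z)⁻¹ ≤ v z := by
  set h : ℝ → ℝ := fun z => √(1 + z ^ 2) with hh
  have hh0 : ∀ z, 0 < h z := fun z => Real.sqrt_pos.2 (by positivity)
  have hsq : ∀ z, h z ^ 2 = 1 + z ^ 2 := fun z => Real.sq_sqrt (by positivity)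
  have hd : ∀ z, HasDerivAt h (z / h z) z := fun z =>
    ((((hasDerivAt_id z).pow 2).const_add 1).sqrt (by simp; positivity)).congr_deriv (by
      have h0 : √(1 + z ^ 2) ≠ 0 := (hh0 z).ne'
      simp only [hh, id]
      field_simp
      simp
      exact mul_div_cancel_right₀ _ h0)
  have hd2 : ∀ z, HasDerivAt (fun z => z / h z) (1 / h z ^ 3) z := fun z =>
    ((hasDerivAt_id z).div (hd z) (hh0 z).ne').congr_deriv (by
      have := (hh0 z).ne'
      simp only [id]
      field_simp
      linarith [hsq z])
  set Z₁ : ℝ := max Z 1 with hZ₁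
  set d : ℝ := min a (1 / h Z₁ ^ 3) with hdd
  have hd0 : 0 < d := lt_min ha (by have := hh0 Z₁; positivity)
  have hgap : ∀ z, d ≤ 1 / h z ^ 3 - 2 * (φ₁ z / φ z) * (z / h z) := fun z => by
    have h1 : 0 < 1 / h z ^ 3 := by have := hh0 z; positivity
    have h2 : 0 ≤ -(2 * (φ₁ z / φ z) * (z / h z)) := by
      have : -(2 * (φ₁ z / φ z) * (z / h z)) = 2 * (-(z * φ₁ z)) / (φ z * h z) := by
        have := (hpos z).ne'
        have := (hh0 z).ne'
        field_simp
      rw [this]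
      exact div_nonneg (mul_nonneg zero_le_two (neg_nonneg.2 (hsign z)))
        (mul_pos (hpos z) (hh0 z)).le
    rcases le_total Z₁ |z| with hz | hz
    · have h3 := hfar z ((le_max_left _ _).trans hz)
      have h4 : 1 ≤ |z| := (le_max_right _ _).trans hz
      have h5 : h z ≤ 2 * |z| := by
        refine abs_le_of_sq_le_sq' ?_ (by positivity) |>.2
        rw [hsq, mul_pow, sq_abs]
        nlinarith [sq_abs z]
      have h6 : -(2 * (φ₁ z / φ z) * (z / h z)) = 2 * |z| * |φ₁ z| / (h z * φ z) := by
        rw [mul_assoc 2 |z|, ← abs_mul, abs_of_nonpos (hsign z)]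
        have := (hpos z).ne'
        have := (hh0 z).ne'
        field_simp
      have h7 : a ≤ 2 * |z| * |φ₁ z| / (h z * φ z) := by
        rw [le_div_iff₀ (mul_pos (hh0 z) (hpos z))]
        calc a * (h z * φ z) = h z * (a * φ z) := by ring
          _ ≤ 2 * |z| * |φ₁ z| :=
            mul_le_mul h5 h3 (mul_pos ha (hpos z)).le (by positivity)
      linarith [min_le_left a (1 / h Z₁ ^ 3)]
    · have h3 : h z ≤ h Z₁ := Real.sqrt_le_sqrt (by
        have : z ^ 2 ≤ Z₁ ^ 2 := sq_le_sq.2 (hz.trans (le_abs_self _))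
        linarith)
      have h4 : 1 / h Z₁ ^ 3 ≤ 1 / h z ^ 3 :=
        one_div_le_one_div_of_le (pow_pos (hh0 z) 3) (pow_le_pow_left₀ (hh0 z).le h3 3)
      linarith [min_le_right a (1 / h Z₁ ^ 3)]
  set ε : ℝ := d / 2 with hε
  have hε0 : 0 < ε := by positivity
  have hεa : ε < a := by linarith [min_le_left a (1 / h Z₁ ^ 3)]
  set q : ℝ → ℝ := fun z => Real.exp (-(ε * h z)) with hq
  have hq0 : ∀ z, 0 < q z := fun z => Real.exp_pos _
  have hqd : ∀ z, HasDerivAt q (-(ε * (z / h z)) * q z) z := fun z =>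
    ((hd z).const_mul ε).neg.exp.congr_deriv (by simp only [hq, Pi.neg_apply]; ring)
  have hqd2 : ∀ z, HasDerivAt (fun z => -(ε * (z / h z)) * q z)
      ((-(ε * (1 / h z ^ 3)) + (ε * (z / h z)) ^ 2) * q z) z := fun z =>
    (((hd2 z).const_mul ε).neg.mul (hqd z)).congr_deriv (by simp; ring)
  refine ⟨fun z => q z / φ z ^ 2,
    fun z => (-(ε * (z / h z)) * q z) / φ z ^ 2 - 2 * (φ₁ z / φ z) * (q z / φ z ^ 2),
    fun z => (-(ε * (1 / h z ^ 3)) + (ε * (z / h z)) ^ 2 + 2 * ε * (z / h z) * (φ₁ z / φ z))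
      * (q z / φ z ^ 2), ε * (d / 2), by positivity,
    fun z => div_pos (hq0 z) (pow_pos (hpos z) 2), fun z => ?_, fun z => ?_, fun z => ?_,
    fun N => ?_⟩
  · refine ((hqd z).div ((hφ z).pow 2) (pow_pos (hpos z) 2).ne').congr_deriv ?_
    have := (hpos z).ne'
    have := (hh0 z).ne'
    simp
    field_simp
  · simp only [sub_add_cancel]
    refine ((hqd2 z).div ((hφ z).pow 2) (pow_pos (hpos z) 2).ne').congr_deriv ?_
    have := (hpos z).ne'
    have := (hh0 z).ne'
    simp
    field_simp
  · refine mul_le_mul_of_nonneg_right ?_ (div_pos (hq0 z) (pow_pos (hpos z) 2)).le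
    have h1 : (z / h z) ^ 2 ≤ 1 := by
      rw [div_pow, hsq, div_le_one (by positivity)]; linarith
    have h2 := mul_le_mul_of_nonneg_left (hgap z) hε0.le
    have h3 := mul_le_mul_of_nonneg_left h1 (sq_nonneg ε)
    have h4 : ε ^ 2 * 1 = ε * (d / 2) := by rw [hε]; ring
    linarith
  · refine ⟨max Z (|N| * |C| * Real.exp ε / (a - ε)), fun z hz => ?_⟩
    have h1 := hdecay z ((le_max_left _ _).trans hz)
    have h2 := (le_max_right _ _).trans hz
    rw [div_le_iff₀ (sub_pos.2 hεa)] at h2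
    have h3 : |N| * |C| * Real.exp ε ≤ Real.exp (|z| * (a - ε)) :=
      h2.trans ((Real.add_one_le_exp _).trans' (by linarith))
    have h4 : h z ≤ 1 + |z| := by
      refine abs_le_of_sq_le_sq' ?_ (by positivity) |>.2
      rw [hsq]; nlinarith [sq_abs z, abs_nonneg z]
    have h5 : N * φ z ≤ q z := by
      calc N * φ z ≤ |N| * φ z := mul_le_mul_of_nonneg_right (le_abs_self N) (hpos z).le
        _ ≤ |N| * (|C| * Real.exp (-(a * |z|))) := mul_le_mul_of_nonneg_left
            (h1.trans (mul_le_mul_of_nonneg_right (le_abs_self C) (Real.exp_pos _).le))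
            (abs_nonneg N)
        _ = |N| * |C| * Real.exp ε * Real.exp (-ε - a * |z|) := by
            rw [mul_assoc _ (Real.exp ε), ← Real.exp_add]; ring_nf
        _ ≤ Real.exp (|z| * (a - ε)) * Real.exp (-ε - a * |z|) :=
            mul_le_mul_of_nonneg_right h3 (Real.exp_pos _).le
        _ = Real.exp (-(ε * (1 + |z|))) := by rw [← Real.exp_add]; ring_nf
        _ ≤ q z := Real.exp_le_exp.2 (neg_le_neg (mul_le_mul_of_nonneg_left h4 hε0.le))
    have h6 := hpos z
    rw [le_div_iff₀ (by positivity)]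
    calc N * (φ z)⁻¹ * φ z ^ 2 = N * φ z := by field_simp
      _ ≤ q z := h5

lemma ContDiff.two_of_smooth {f : ℝ → ℝ} (h : ContDiff ℝ (⊤ : ℕ∞) f) : ContDiff ℝ 2 f :=
  contDiff_infty.1 h 2

lemma hasDerivAt_div_deriv {w φ φ₁ : ℝ → ℝ} (hw : ContDiff ℝ 2 w) (hφ : ∀ z, HasDerivAt φ (φ₁ z) z)
    (hpos : ∀ z, 0 < φ z) (z : ℝ) :
    HasDerivAt (fun t => w t / φ t) ((deriv w z - w z * (φ₁ z / φ z)) / φ z) z := by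
  refine ((hw.hasDerivAt_of_two z).div (hφ z) (hpos z).ne').congr_deriv ?_
  have := (hpos z).ne'
  field_simp

lemma iteratedDeriv_two_div_add {w φ φ₁ V : ℝ → ℝ} (hw : ContDiff ℝ 2 w)
    (hφ : ∀ z, HasDerivAt φ (φ₁ z) z) (hφ₁ : ∀ z, HasDerivAt φ₁ (V z * φ z) z)
    (hpos : ∀ z, 0 < φ z) (z : ℝ) :
    iteratedDeriv 2 (fun t => w t / φ t) z
      + 2 * (φ₁ z / φ z) * deriv (fun t => w t / φ t) z
      = (iteratedDeriv 2 w z - V z * w z) / φ z := by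
  have hne := (hpos z).ne'
  rw [(hasDerivAt_div_deriv hw hφ hpos z).deriv, iteratedDeriv_two_eq (hasDerivAt_div_deriv hw hφ hpos)
    (((hw.hasDerivAt_deriv_two z).sub ((hw.hasDerivAt_of_two z).mul
      ((hφ₁ z).div (hφ z) hne))).div (hφ z) hne)]
  simp
  field_simp
  ring

/-- Pointwise and asymptotic bounds for the derivative of a heteroclinic solution. -/
lemma heteroclinic_bounds {H φ φ₁ V : ℝ → ℝ} (hH : ∀ z, HasDerivAt H (φ z) z)
    (hφ : ∀ z, HasDerivAt φ (φ₁ z) z) (hφ₁ : ∀ z, HasDerivAt φ₁ (V z * φ z) z) {l l' : ℝ}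
    (hl : Tendsto H atTop (nhds l)) (hl' : Tendsto H atBot (nhds l')) (hpos : ∀ z, 0 < φ z)
    (hneg : ∀ z, 0 ≤ z → φ₁ z ≤ 0) (hneg' : ∀ z, z ≤ 0 → 0 ≤ φ₁ z)
    (hlim : Tendsto φ₁ atTop (nhds 0)) (hlim' : Tendsto φ₁ atBot (nhds 0)) {K a Z : ℝ}
    (hK : 0 ≤ K) (hZ : 0 ≤ Z) (hVK : ∀ z, V z ≤ K ^ 2) (hVa : ∀ z, Z ≤ |z| → a ^ 2 ≤ V z) :
    (∀ z, |φ₁ z| ≤ K * φ z) ∧ (∀ z, Z ≤ |z| → a * φ z ≤ |φ₁ z|) ∧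
      ∃ C, ∀ z, Z ≤ |z| → φ z ≤ C * Real.exp (-(a * |z|)) := by
  obtain ⟨p1, p2, p3⟩ := half_line_bounds hH hφ hφ₁ hl hpos hneg hlim hK hZ hVK
    fun z hz => hVa z (hz.trans (le_abs_self z))
  have hrefl : ∀ {F F' : ℝ → ℝ}, (∀ z, HasDerivAt F (F' z) z) →
      ∀ z, HasDerivAt (fun t => F (-t)) (-F' (-z)) z := fun h z => by
    exact ((h (-z)).comp z (hasDerivAt_neg z)).congr_deriv (by simp)
  obtain ⟨n1, n2, n3⟩ := half_line_bounds (H := fun z => -H (-z)) (φ := fun z => φ (-z))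
    (φ₁ := fun z => -φ₁ (-z)) (V := fun z => V (-z))
    (fun z => (hrefl hH z).neg.congr_deriv (neg_neg _)) (hrefl hφ)
    (fun z => (hrefl hφ₁ z).neg.congr_deriv (neg_neg _))
    (hl'.comp tendsto_neg_atTop_atBot).neg (fun z => hpos _)
    (fun z hz => neg_nonpos.2 (hneg' _ (neg_nonpos.2 hz)))
    (by simpa using (hlim'.comp tendsto_neg_atTop_atBot).neg) hK hZ (fun z => hVK _)
    (a := a) (fun z hz => hVa _ (by rw [abs_neg]; exact hz.trans (le_abs_self z)))
  simp only [abs_neg] at n1 n2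
  refine ⟨fun z => ?_, fun z hz => ?_,
    max (φ Z * Real.exp (a * Z)) (φ (-Z) * Real.exp (a * Z)), fun z hz => ?_⟩
  · rcases le_total 0 z with h | h
    · exact p1 z h
    · simpa using n1 (-z) (neg_nonneg.2 h)
  · rcases le_total 0 z with h | h
    · exact p2 z (by rwa [abs_of_nonneg h] at hz)
    · simpa using n2 (-z) (by rwa [abs_of_nonpos h] at hz)
  · rcases le_total 0 z with h | h
    · rw [abs_of_nonneg h] at hz ⊢
      exact (p3 z hz).trans (mul_le_mul_of_nonneg_right (le_max_left _ _) (Real.exp_pos _).le)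
    · rw [abs_of_nonpos h] at hz ⊢
      have := n3 (-z) hz
      rw [neg_neg] at this
      exact this.trans (mul_le_mul_of_nonneg_right (le_max_right _ _) (Real.exp_pos _).le)

/-- a bounded entire solution of
`Δ_{ℝ^{n-1}} w + ∂_z² w − W''(ℍ(z)) w = f(y) ℍ'(z)` is of the form `c(y) ℍ'(z)`,
with `Δ c = f`. -/
theorem bounded_solution_is_multiple_of_Hprime
    (n : ℕ) (hn : 2 ≤ n)
    (W ℍ : ℝ → ℝ)
    (hWsmooth : ContDiff ℝ (⊤ : ℕ∞) W)
    (hWnonneg : ∀ x, 0 ≤ W x)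
    (hWzero : ∀ x, W x = 0 ↔ x = 1 ∨ x = -1)
    (hW'zero : deriv W 0 = 0)
    (hW''zero : iteratedDeriv 2 W 0 ≠ 0)
    (hWwell : ∀ x : ℝ, 0 < |x| → |x| < 1 → x * deriv W x < 0)
    (hWconv : ∃ κ > (0:ℝ), ∃ β ∈ Set.Ioo (0:ℝ) 1, ∀ x : ℝ, 1 - β ≤ |x| → κ ≤ iteratedDeriv 2 W x)
    (hWsymm : ∀ x, W (-x) = W x)
    (hHsmooth : ContDiff ℝ (⊤ : ℕ∞) ℍ)
    (hHrange : ∀ t, ℍ t ∈ Set.Ioo (-1:ℝ) 1)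
    (hHode : ∀ t, iteratedDeriv 2 ℍ t = deriv W (ℍ t))
    (hHzero : ℍ 0 = 0)
    (hHmono : ∀ t, 0 < deriv ℍ t)
    (hHtop : Filter.Tendsto ℍ Filter.atTop (nhds 1))
    (hHbot : Filter.Tendsto ℍ Filter.atBot (nhds (-1)))
    (w : (Fin (n - 1) → ℝ) → ℝ → ℝ)
    (hw : ContDiff ℝ 2 (fun p : (Fin (n - 1) → ℝ) × ℝ => w p.1 p.2))
    (hwB : ∃ M : ℝ, ∀ y z, |w y z| ≤ M)
    (f : (Fin (n - 1) → ℝ) → ℝ)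
    (hf : Continuous f)
    (hfB : ∃ M : ℝ, ∀ y, |f y| ≤ M)
    (hpde : ∀ y z, lapPi (fun y' => w y' z) y + iteratedDeriv 2 (w y) z
        - iteratedDeriv 2 W (ℍ z) * w y z = f y * deriv ℍ z) :
    ∃ c : (Fin (n - 1) → ℝ) → ℝ, ContDiff ℝ 2 c ∧
      (∀ y z, w y z = c y * deriv ℍ z) ∧ (∀ y, lapPi c y = f y) := by
  obtain ⟨κ, hκ, β, ⟨hβ0, -⟩, hconv⟩ := hWconv
  obtain ⟨M, hM⟩ := hwB
  obtain ⟨Mf, hMf⟩ := hfB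
  have hW2 := hWsmooth.two_of_smooth
  have hH2 := hHsmooth.two_of_smooth
  set φ : ℝ → ℝ := deriv ℍ with hφdef
  set φ₁ : ℝ → ℝ := fun z => deriv W (ℍ z) with hφ₁def
  set V : ℝ → ℝ := fun z => iteratedDeriv 2 W (ℍ z) with hVdef
  have hH : ∀ z, HasDerivAt ℍ (φ z) z := hH2.hasDerivAt_of_two
  have hφ : ∀ z, HasDerivAt φ (φ₁ z) z := fun z =>
    (hH2.hasDerivAt_deriv_two z).congr_deriv (hHode z)
  have hφ₁ : ∀ z, HasDerivAt φ₁ (V z * φ z) z := fun z =>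
    (hW2.hasDerivAt_deriv_two (ℍ z)).comp z (hH z)
  have hφC : ContDiff ℝ 2 φ := by
    have : ContDiff ℝ (⊤ : ℕ∞) φ := (contDiff_infty_iff_deriv.1 hHsmooth).2
    exact this.two_of_smooth
  have hmono : StrictMono ℍ := strictMono_of_deriv_pos hHmono
  have hneg : ∀ z, 0 ≤ z → φ₁ z ≤ 0 := fun z hz => by
    rcases hz.eq_or_lt with rfl | hz
    · simp [hφ₁def, hHzero, hW'zero]
    · have h0 : 0 < ℍ z := hHzero ▸ hmono hz
      have := hWwell (ℍ z) (abs_pos.2 h0.ne') (abs_lt.2 (hHrange z))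
      exact (neg_of_mul_neg_right this h0.le).le
  have hneg' : ∀ z, z ≤ 0 → 0 ≤ φ₁ z := fun z hz => by
    rcases hz.eq_or_lt with rfl | hz
    · simp [hφ₁def, hHzero, hW'zero]
    · have h0 : ℍ z < 0 := hHzero ▸ hmono hz
      have := hWwell (ℍ z) (abs_pos.2 h0.ne) (abs_lt.2 (hHrange z))
      exact (pos_of_mul_neg_right this h0.le).le
  have hcrit : ∀ x, W x = 0 → deriv W x = 0 := fun x hx => by
    have : IsLocalMin W x := Eventually.of_forall fun t => hx ▸ hWnonneg t
    exact this.deriv_eq_zero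
  have hW1c : Continuous (deriv W) := hW2.continuous_deriv (by norm_num)
  have hlim : Tendsto φ₁ atTop (nhds 0) := by
    rw [← hcrit 1 ((hWzero 1).2 (Or.inl rfl))]
    exact (hW1c.tendsto 1).comp hHtop
  have hlim' : Tendsto φ₁ atBot (nhds 0) := by
    rw [← hcrit (-1) ((hWzero (-1)).2 (Or.inr rfl))]
    exact (hW1c.tendsto (-1)).comp hHbot
  obtain ⟨K, hK⟩ : ∃ K, ∀ z, |V z| ≤ K := by
    obtain ⟨K, hK⟩ := (isCompact_Icc (a := (-1 : ℝ)) (b := 1)).exists_bound_of_continuousOn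
      (hW2.continuous_iteratedDeriv 2 (by norm_num)).continuousOn
    exact ⟨K, fun z => hK _ ⟨(hHrange z).1.le, (hHrange z).2.le⟩⟩
  have hK0 : 0 ≤ K := (abs_nonneg _).trans (hK 0)
  obtain ⟨Z, hZ0, hZ⟩ : ∃ Z, 0 ≤ Z ∧ ∀ z, Z ≤ |z| → κ ≤ V z := by
    obtain ⟨Z₁, h1⟩ := eventually_atTop.1 (hHtop.eventually (lt_mem_nhds (sub_lt_self 1 hβ0)))
    obtain ⟨Z₂, h2⟩ := eventually_atBot.1
      (hHbot.eventually (gt_mem_nhds (lt_add_of_pos_right (-1) hβ0)))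
    refine ⟨max 0 (max Z₁ (-Z₂)), le_max_left _ _, fun z hz => hconv _ ?_⟩
    have hz1 : Z₁ ≤ |z| := ((le_max_left _ _).trans (le_max_right _ _)).trans hz
    have hz2 : -Z₂ ≤ |z| := ((le_max_right _ _).trans (le_max_right _ _)).trans hz
    rcases le_total 0 z with h | h
    · rw [abs_of_nonneg h] at hz1
      exact (h1 z hz1).le.trans (le_abs_self _)
    · rw [abs_of_nonpos h] at hz2
      have := h2 z (neg_le_neg_iff.1 hz2)
      exact le_trans (by linarith) (neg_le_abs (ℍ z))
  obtain ⟨b1, b2, C, b3⟩ := heteroclinic_bounds hH hφ hφ₁ hHtop hHbot hHmono hneg hneg' hlim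
    hlim' (K := √K) (a := √κ) (Real.sqrt_nonneg _) hZ0
    (fun z => by rw [Real.sq_sqrt hK0]; exact (le_abs_self _).trans (hK z))
    (fun z hz => by rw [Real.sq_sqrt hκ.le]; exact hZ z hz)
  have hsign : ∀ z, z * φ₁ z ≤ 0 := fun z => by
    rcases le_total 0 z with h | h
    · exact mul_nonpos_of_nonneg_of_nonpos h (hneg z h)
    · exact mul_nonpos_of_nonpos_of_nonneg h (hneg' z h)
  obtain ⟨v, v₁, r₁, δ, hδ, hv0, hv, hr, hrv, hvb⟩ :=
    exists_weight hφ hHmono hsign (Real.sqrt_pos.2 hκ) b2 b3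
  have hφle : ∀ z, φ z ≤ φ 0 := fun z => by
    rcases le_total 0 z with h | h
    · exact neg_le_neg_iff.1 (monotoneOn_of_hasDerivAt (convex_Ici 0) (fun t => (hφ t).neg)
        (fun t ht => neg_nonneg.2 (hneg t ht)) (Set.mem_Ici.2 le_rfl) (Set.mem_Ici.2 h) h)
    · exact monotoneOn_of_hasDerivAt (convex_Iic 0) hφ hneg' (Set.mem_Iic.2 h)
        (Set.mem_Iic.2 le_rfl) h
  have hF : ∀ y z, |lapPi (fun y' => w y' z) y + iteratedDeriv 2 (w y) z|
      ≤ K * M + Mf * φ 0 := fun y z => by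
    have : lapPi (fun y' => w y' z) y + iteratedDeriv 2 (w y) z = V z * w y z + f y * φ z := by
      have := hpde y z
      linarith
    rw [this]
    refine (abs_add_le _ _).trans (add_le_add ?_ ?_) <;> rw [abs_mul]
    · exact mul_le_mul (hK z) (hM y z) (abs_nonneg _) hK0
    · rw [abs_of_pos (hHmono z)]
      exact mul_le_mul (hMf y) (hφle z) (hHmono z).le ((abs_nonneg _).trans (hMf y))
  have hw1 := abs_deriv_snd_le_of_abs_laplacian_le hw hM hF
  set A : ℝ := 2 * M + (K * M + Mf * φ 0 + 1) with hA
  have hM0 : 0 ≤ M := (abs_nonneg _).trans (hM 0 0)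
  have hA0 : 0 ≤ A := (abs_nonneg _).trans (hw1 0 0)
  have hslice : ∀ y, ContDiff ℝ 2 (w y) := fun y => hw.comp (contDiff_prodMk_right y)
  have hψ : ContDiff ℝ 2 fun p : (Fin (n - 1) → ℝ) × ℝ => w p.1 p.2 / φ p.2 :=
    hw.div (hφC.comp contDiff_snd) fun p => (hHmono p.2).ne'
  have hψpde : ∀ y z, lapPi (fun y' => w y' z / φ z) y
      + iteratedDeriv 2 (fun z => w y z / φ z) z
      + 2 * (φ₁ z / φ z) * deriv (fun z => w y z / φ z) z = f y := fun y z => by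
    have hl : lapPi (fun y' => w y' z / φ z) y = lapPi (fun y' => w y' z) y / φ z := by
      simp_rw [div_eq_inv_mul]
      exact lapPi_const_mul _ _ _
    rw [add_assoc, iteratedDeriv_two_div_add (hslice y) hφ hφ₁ hHmono z, hl, ← add_div,
      div_eq_iff (hHmono z).ne', ← hpde y z]
    ring
  set Q : ℝ := φ 0 + (A + M * √K) with hQ
  have hQ0 : 0 ≤ A + M * √K := by positivity
  have hconst := eq_of_weighted_equation (ψ := fun y z => w y z / φ z) hψ hψpde
    (b := fun z => Q * (φ z)⁻¹) (continuous_const.mul (hφC.continuous.inv₀ fun z => (hHmono z).ne'))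
    (fun z => by
      rw [← div_eq_mul_inv, one_le_div (hHmono z)]
      linarith [hφle z])
    (fun y z => by
      rw [(hasDerivAt_div_deriv (hslice y) hφ hHmono z).deriv, abs_div, abs_of_pos (hHmono z),
        div_eq_mul_inv]
      refine mul_le_mul_of_nonneg_right ?_ (inv_pos.2 (hHmono z)).le
      have h1 : |φ₁ z / φ z| ≤ √K := by
        rw [abs_div, abs_of_pos (hHmono z), div_le_iff₀ (hHmono z)]
        exact b1 z
      have h2 : |w y z * (φ₁ z / φ z)| ≤ M * √K := by
        rw [abs_mul]
        exact mul_le_mul (hM y z) h1 (abs_nonneg _) hM0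
      linarith [abs_sub (deriv (w y) z) (w y z * (φ₁ z / φ z)), hw1 y z, hHmono 0])
    hv0 hv hr hδ hrv
    (fun N => by
      obtain ⟨R, hR⟩ := hvb (N * Q)
      exact ⟨R, fun z hz => by rw [← mul_assoc]; exact hR z hz⟩)
  have hwc : ∀ y z, w y z = w y 0 / φ 0 * φ z := fun y z => by
    rw [← hconst y z 0, div_mul_cancel₀ _ (hHmono z).ne']
  refine ⟨fun y => w y 0 / φ 0,
    (hw.comp (contDiff_prodMk_left (0 : ℝ))).div_const _, hwc, fun y => ?_⟩
  have h0 := hψpde y 0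
  have h1 : (fun z => w y z / φ z) = fun _ => w y 0 / φ 0 := funext fun z => hconst y z 0
  rw [h1, iteratedDeriv_const, deriv_const] at h0
  simpa using h0
end

section
/- Let n ≥ 2. Suppose w : ℝ^{n−1} × ℝ → ℝ is a bounded C² function satisfying Δ_{ℝ^{n−1}} w(y,z) + ∂_z² w(y,z) − W''(ℍ(z)) w(y,z) = 0 for every (y,z), and suppose that for every y ∈ ℝ^{n−1} one has ∫_ℝ w(y,z) ℍ'(z) dz = 0. Then w ≡ 0. -/
open MeasureTheory Filter

/-- A function whose derivative is nonnegative to the right of `a` is monotone there. -/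
lemma monotoneOn_Ici_of_hasDerivAt {f f' : ℝ → ℝ} {a : ℝ} (hf : ∀ x, HasDerivAt f (f' x) x)
    (h : ∀ x, a ≤ x → 0 ≤ f' x) : MonotoneOn f (Set.Ici a) :=
  monotoneOn_of_hasDerivWithinAt_nonneg (convex_Ici a)
    (fun x _ => (hf x).continuousAt.continuousWithinAt)
    (fun x _ => (hf x).hasDerivWithinAt)
    (fun x hx => h x (Set.mem_Ici.1 (interior_subset hx)))

/-- A function whose derivative is nonnegative to the left of `a` is monotone there. -/
lemma monotoneOn_Iic_of_hasDerivAt {f f' : ℝ → ℝ} {a : ℝ} (hf : ∀ x, HasDerivAt f (f' x) x)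
    (h : ∀ x, x ≤ a → 0 ≤ f' x) : MonotoneOn f (Set.Iic a) :=
  monotoneOn_of_hasDerivWithinAt_nonneg (convex_Iic a)
    (fun x _ => (hf x).continuousAt.continuousWithinAt)
    (fun x _ => (hf x).hasDerivWithinAt)
    (fun x hx => h x (Set.mem_Iic.1 (interior_subset hx)))

/-- The derivative of `x ↦ f x * exp (a * x)`. -/
lemma HasDerivAt.mul_exp_linear {f : ℝ → ℝ} {f' x : ℝ} (hf : HasDerivAt f f' x) (a : ℝ) :
    HasDerivAt (fun x => f x * Real.exp (a * x)) ((f' + a * f x) * Real.exp (a * x)) x := by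
  have h : HasDerivAt (fun x => Real.exp (a * x)) (Real.exp (a * x) * a) x := by
    simpa using ((hasDerivAt_id x).const_mul a).exp
  exact (hf.mul h).congr_deriv (by ring)

/-- A positive solution of `φ'' = V φ` with `V ≤ Λ²` satisfies `φ' ≤ Λ φ`. -/
lemma deriv_le_mul_of_pos_solution {φ ψ V : ℝ → ℝ} {Λ : ℝ} (hΛ : 0 ≤ Λ)
    (hpos : ∀ t, 0 < φ t) (hφ : ∀ t, HasDerivAt φ (ψ t) t)
    (hψ : ∀ t, HasDerivAt ψ (V t * φ t) t) (hV : ∀ t, V t ≤ Λ ^ 2) (t : ℝ) :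
    ψ t ≤ Λ * φ t := by
  by_contra! hlt
  set c := ψ t - Λ * φ t with hc
  have hcpos : 0 < c := by linarith
  have hE : ∀ x, HasDerivAt (fun x => -((ψ x - Λ * φ x) * Real.exp (Λ * x)))
      (-((V x * φ x - Λ * ψ x + Λ * (ψ x - Λ * φ x)) * Real.exp (Λ * x))) x := fun x =>
    (((hψ x).sub ((hφ x).const_mul Λ)).mul_exp_linear Λ).neg
  have hmono := monotoneOn_Iic_of_hasDerivAt (a := t) hE (fun x _ => by
    have h1 : (V x * φ x - Λ * ψ x + Λ * (ψ x - Λ * φ x)) ≤ 0 := by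
      nlinarith [mul_le_mul_of_nonneg_right (hV x) (hpos x).le]
    nlinarith [Real.exp_pos (Λ * x)])
  have hlow : ∀ x, x ≤ t → c ≤ ψ x - Λ * φ x := by
    intro x hx
    have h1 := hmono (Set.mem_Iic.2 hx) (Set.mem_Iic.2 le_rfl) hx
    have h2 : Real.exp (Λ * x) ≤ Real.exp (Λ * t) :=
      Real.exp_le_exp.2 (mul_le_mul_of_nonneg_left hx hΛ)
    simp only [← hc] at h1
    by_contra! h3
    nlinarith [Real.exp_pos (Λ * x), mul_lt_mul_of_pos_right h3 (Real.exp_pos (Λ * x))]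
  have hlin : ∀ x, HasDerivAt (fun x => φ x - c * x) (ψ x - c * 1) x := fun x =>
    (hφ x).sub ((hasDerivAt_id x).const_mul c)
  have hmono2 := monotoneOn_Iic_of_hasDerivAt (a := t) hlin (fun x hx => by
    nlinarith [hlow x hx, mul_nonneg hΛ (hpos x).le])
  have hle : t - φ t / c ≤ t := by
    have := div_pos (hpos t) hcpos
    linarith
  have h1 := hmono2 (Set.mem_Iic.2 hle) (Set.mem_Iic.2 le_rfl) hle
  have h2 : c * (t - φ t / c) = c * t - φ t := by field_simp
  simp only [h2] at h1
  linarith [hpos (t - φ t / c)]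

/-- If `φ = H'` with `H` bounded and `φ'' = V φ` with `V ≥ a²` on `[R, ∞)`, then `φ' ≤ -a φ`
there. -/
lemma deriv_le_neg_mul_of_pos_solution {H φ ψ V : ℝ → ℝ} {a R : ℝ} (ha : 0 < a)
    (hpos : ∀ t, 0 < φ t) (hH : ∀ t, HasDerivAt H (φ t) t) (hφ : ∀ t, HasDerivAt φ (ψ t) t)
    (hψ : ∀ t, HasDerivAt ψ (V t * φ t) t) (hHb : ∀ t, |H t| ≤ 1)
    (hV : ∀ t, R ≤ t → a ^ 2 ≤ V t) (t : ℝ) (ht : R ≤ t) :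
    ψ t ≤ -a * φ t := by
  by_contra! hlt
  set c := ψ t + a * φ t with hc
  have hcpos : 0 < c := by linarith
  have hE : ∀ x, HasDerivAt (fun x => (ψ x + a * φ x) * Real.exp (-a * x))
      ((V x * φ x + a * ψ x + -a * (ψ x + a * φ x)) * Real.exp (-a * x)) x := fun x =>
    ((hψ x).add ((hφ x).const_mul a)).mul_exp_linear (-a)
  have hmono := monotoneOn_Ici_of_hasDerivAt (a := t) hE (fun x hx => by
    have h1 : 0 ≤ (V x * φ x + a * ψ x + -a * (ψ x + a * φ x)) := by
      nlinarith [mul_le_mul_of_nonneg_right (hV x (ht.trans hx)) (hpos x).le]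
    exact mul_nonneg h1 (Real.exp_pos _).le)
  have hlow : ∀ x, t ≤ x → c ≤ ψ x + a * φ x := by
    intro x hx
    have h1 := hmono (Set.mem_Ici.2 le_rfl) (Set.mem_Ici.2 hx) hx
    have h2 : Real.exp (-a * x) ≤ Real.exp (-a * t) :=
      Real.exp_le_exp.2 (by nlinarith)
    simp only [← hc] at h1
    by_contra! h3
    nlinarith [Real.exp_pos (-a * x), mul_lt_mul_of_pos_right h3 (Real.exp_pos (-a * x))]
  have hlin : ∀ x, HasDerivAt (fun x => φ x + a * H x - c * x) (ψ x + a * φ x - c * 1) x :=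
    fun x => ((hφ x).add ((hH x).const_mul a)).sub ((hasDerivAt_id x).const_mul c)
  have hmono2 := monotoneOn_Ici_of_hasDerivAt (a := t) hlin (fun x hx => by
    linarith [hlow x hx])
  have hHb' := fun x => abs_le.1 (hHb x)
  have hgrow : ∀ x, t + (2 * a + 2) / c ≤ x → 2 ≤ φ x := by
    intro x hx
    have h0 : 0 < (2 * a + 2) / c := by positivity
    have h1 := hmono2 (Set.mem_Ici.2 le_rfl) (Set.mem_Ici.2 (show t ≤ x by linarith))
      (show t ≤ x by linarith)
    have h2 : c * (t + (2 * a + 2) / c) = c * t + (2 * a + 2) := by field_simp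
    have h3 := mul_le_mul_of_nonneg_left hx hcpos.le
    simp only at h1
    nlinarith [hHb' x, hHb' t, hpos t]
  set x₀ := t + (2 * a + 2) / c
  have hlin2 : ∀ x, HasDerivAt (fun x => H x - 2 * x) (φ x - 2 * 1) x := fun x =>
    (hH x).sub ((hasDerivAt_id x).const_mul 2)
  have hmono3 := monotoneOn_Ici_of_hasDerivAt (a := x₀) hlin2 (fun x hx => by
    linarith [hgrow x hx])
  have h1 := hmono3 (Set.mem_Ici.2 le_rfl) (Set.mem_Ici.2 (show x₀ ≤ x₀ + 2 by linarith))
    (show x₀ ≤ x₀ + 2 by linarith)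
  simp only at h1
  linarith [hHb' x₀, hHb' (x₀ + 2)]

/-- The primitive of `φ⁻²` vanishing at `0`. -/
lemma hasDerivAt_integral_inv_sq {φ : ℝ → ℝ} (hpos : ∀ t, 0 < φ t) (hc : Continuous φ) (t : ℝ) :
    HasDerivAt (fun t => ∫ s in (0 : ℝ)..t, (φ s ^ 2)⁻¹) ((φ t ^ 2)⁻¹) t :=
  (Continuous.integral_hasStrictDerivAt
    ((hc.pow 2).inv₀ fun s => (pow_pos (hpos s) 2).ne') 0 t).hasDerivAt

/-- Control, on the right half-line, of the tail of `φ` and of the primitive of `φ⁻²` in terms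
of `φ`. -/
lemma exists_right_tail_bounds {H φ ψ V : ℝ → ℝ} {a R : ℝ} (ha : 0 < a)
    (hpos : ∀ t, 0 < φ t) (hH : ∀ t, HasDerivAt H (φ t) t) (hφ : ∀ t, HasDerivAt φ (ψ t) t)
    (hψ : ∀ t, HasDerivAt ψ (V t * φ t) t) (hHb : ∀ t, |H t| ≤ 1)
    (hV : ∀ t, R ≤ t → a ^ 2 ≤ V t) (hlim : Tendsto H atTop (nhds 1)) :
    ∃ C, ∀ t, 0 ≤ t → 1 - H t ≤ C * φ t ∧
      |φ t ^ 2 * ∫ s in (0 : ℝ)..t, (φ s ^ 2)⁻¹| ≤ C := by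
  have hdec : ∀ t, R ≤ t → ψ t ≤ -a * φ t :=
    deriv_le_neg_mul_of_pos_solution ha hpos hH hφ hψ hHb hV
  have hcφ : Continuous φ := continuous_iff_continuousAt.2 fun t => (hφ t).continuousAt
  have hcH : Continuous H := continuous_iff_continuousAt.2 fun t => (hH t).continuousAt
  set T : ℝ → ℝ := fun t => ∫ s in (0 : ℝ)..t, (φ s ^ 2)⁻¹ with hT
  have hTd : ∀ t, HasDerivAt T ((φ t ^ 2)⁻¹) t := hasDerivAt_integral_inv_sq hpos hcφ
  have hcT : Continuous T := continuous_iff_continuousAt.2 fun t => (hTd t).continuousAt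
  have hTnn : ∀ t, 0 ≤ t → 0 ≤ T t := fun t ht =>
    intervalIntegral.integral_nonneg ht fun s _ => by positivity
  obtain ⟨C₁, hC₁⟩ := (isCompact_Icc (a := (0 : ℝ)) (b := R)).exists_bound_of_continuousOn
    (f := fun t => (1 - H t) / φ t)
    ((continuous_const.sub hcH).div hcφ fun t => (hpos t).ne').continuousOn
  obtain ⟨C₂, hC₂⟩ := (isCompact_Icc (a := (0 : ℝ)) (b := R)).exists_bound_of_continuousOn
    (f := fun t => φ t ^ 2 * T t) ((hcφ.pow 2).mul hcT).continuousOn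
  -- beyond `R`, the two quantities are monotone up to an explicit correction
  have hm1 := monotoneOn_Ici_of_hasDerivAt (a := R)
    (fun x => ((hφ x).add ((hH x).const_mul a)).neg)
    (fun x hx => by linarith [hdec x hx])
  have htail : ∀ t, R ≤ t → a * (1 - H t) ≤ φ t := by
    intro t ht
    have hl : Tendsto (fun x => a * H x) atTop (nhds (a * 1)) := hlim.const_mul a
    have : a * 1 ≤ φ t + a * H t := by
      refine le_of_tendsto hl ?_
      filter_upwards [eventually_ge_atTop t] with x hx
      have h1 := hm1 (Set.mem_Ici.2 ht) (Set.mem_Ici.2 (ht.trans hx)) hx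
      simp only [Pi.neg_apply, Pi.add_apply] at h1
      linarith [hpos x]
    linarith
  have hinv : ∀ x, HasDerivAt (fun x => (φ x ^ 2)⁻¹) (-(2 * φ x * ψ x) / (φ x ^ 2) ^ 2) x := by
    intro x
    have h := ((hφ x).fun_pow 2).fun_inv (pow_pos (hpos x) 2).ne'
    exact h.congr_deriv (by norm_num)
  have hm2 := monotoneOn_Ici_of_hasDerivAt (a := R)
    (fun x => ((hinv x).div_const (2 * a)).sub (hTd x))
    (fun x hx => by
      have h1 := hdec x hx
      have h2 := hpos x
      have h3 : -(2 * φ x * ψ x) / (φ x ^ 2) ^ 2 / (2 * a) - (φ x ^ 2)⁻¹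
          = (-ψ x - a * φ x) / (a * φ x ^ 3) := by
        field_simp
      rw [h3]
      exact div_nonneg (by linarith) (by positivity))
  have hm3 := monotoneOn_Ici_of_hasDerivAt (a := R) (fun x => (hφ x).neg)
    (fun x hx => by nlinarith [hdec x hx, hpos x])
  set N := |T R| + (φ R ^ 2)⁻¹ / (2 * a) with hN
  have hN0 : 0 ≤ N := by positivity
  refine ⟨|C₁| + |C₂| + 1 / a + 1 / (2 * a) + N * φ R ^ 2, fun t ht => ?_⟩
  have e1 : 0 ≤ |C₁| := abs_nonneg _
  have e2 : 0 ≤ |C₂| := abs_nonneg _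
  have e3 : 0 ≤ 1 / a := by positivity
  have e4 : 0 ≤ 1 / (2 * a) := by positivity
  have e5 : 0 ≤ N * φ R ^ 2 := by positivity
  rcases le_total t R with htR | htR
  · have h1 := (le_abs_self _).trans ((hC₁ t ⟨ht, htR⟩).trans (le_abs_self _))
    have h2 := (hC₂ t ⟨ht, htR⟩).trans (le_abs_self _)
    rw [Real.norm_eq_abs] at h2
    constructor
    · rw [div_le_iff₀ (hpos t)] at h1
      nlinarith [hpos t]
    · linarith
  · constructor
    · have h1 := htail t htR
      have h2 : 1 - H t ≤ 1 / a * φ t := by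
        rw [div_mul_eq_mul_div, one_mul, le_div_iff₀ ha]
        linarith
      nlinarith [hpos t]
    · have h1 := hm2 (Set.mem_Ici.2 le_rfl) (Set.mem_Ici.2 htR) htR
      have h2 := hm3 (Set.mem_Ici.2 le_rfl) (Set.mem_Ici.2 htR) htR
      simp only [Pi.neg_apply, Pi.sub_apply] at h1 h2
      have h3 : T t ≤ (φ t ^ 2)⁻¹ / (2 * a) + N := by
        have h4 : 0 ≤ (φ R ^ 2)⁻¹ / (2 * a) := by positivity
        rw [hN]
        linarith [le_abs_self (T R)]
      have h5 : φ t ^ 2 * T t ≤ 1 / (2 * a) + N * φ R ^ 2 := by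
        calc φ t ^ 2 * T t ≤ φ t ^ 2 * ((φ t ^ 2)⁻¹ / (2 * a) + N) := by gcongr
          _ = 1 / (2 * a) + N * φ t ^ 2 := by
            have := (hpos t).ne'
            field_simp
          _ ≤ 1 / (2 * a) + N * φ R ^ 2 := by
            have : φ t ^ 2 ≤ φ R ^ 2 := pow_le_pow_left₀ (hpos t).le (by linarith) 2
            gcongr
      rw [abs_of_nonneg (mul_nonneg (by positivity) (hTnn t ht))]
      linarith

/-- The mirror image of `exists_right_tail_bounds`. -/
lemma exists_left_tail_bounds {H φ ψ V : ℝ → ℝ} {a R : ℝ} (ha : 0 < a)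
    (hpos : ∀ t, 0 < φ t) (hH : ∀ t, HasDerivAt H (φ t) t) (hφ : ∀ t, HasDerivAt φ (ψ t) t)
    (hψ : ∀ t, HasDerivAt ψ (V t * φ t) t) (hHb : ∀ t, |H t| ≤ 1)
    (hV : ∀ t, t ≤ -R → a ^ 2 ≤ V t) (hlim : Tendsto H atBot (nhds (-1))) :
    ∃ C, ∀ t, t ≤ 0 → H t + 1 ≤ C * φ t ∧
      |φ t ^ 2 * ∫ s in (0 : ℝ)..t, (φ s ^ 2)⁻¹| ≤ C := by
  have hneg : ∀ {f : ℝ → ℝ} {f' : ℝ → ℝ}, (∀ t, HasDerivAt f (f' t) t) →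
      ∀ t, HasDerivAt (fun t => f (-t)) (-f' (-t)) t := by
    intro f f' h t
    have := (h (-t)).comp t (hasDerivAt_neg t)
    exact this.congr_deriv (by ring)
  obtain ⟨C, hC⟩ := exists_right_tail_bounds (H := fun t => -H (-t)) (φ := fun t => φ (-t))
    (ψ := fun t => -ψ (-t)) (V := fun t => V (-t)) (R := R) ha (fun t => hpos _)
    (fun t => ((hneg hH t).neg).congr_deriv (by ring)) (hneg hφ)
    (fun t => ((hneg hψ t).neg).congr_deriv (by ring)) (fun t => by simpa using hHb (-t))
    (fun t ht => hV _ (by linarith)) (by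
      have := (hlim.comp tendsto_neg_atTop_atBot).neg
      simpa using this)
  refine ⟨C, fun t ht => ?_⟩
  obtain ⟨h1, h2⟩ := hC (-t) (by linarith)
  simp only [neg_neg] at h1 h2
  refine ⟨by linarith, ?_⟩
  have h3 : ∫ s in (0 : ℝ)..(-t), (φ (-s) ^ 2)⁻¹ = -∫ s in (0 : ℝ)..t, (φ s ^ 2)⁻¹ := by
    rw [intervalIntegral.integral_comp_neg (fun s => (φ s ^ 2)⁻¹), neg_neg, neg_zero,
      intervalIntegral.integral_symm]
  rw [h3, mul_neg, abs_neg] at h2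
  exact h2

/-- The antiderivative of `f φ` vanishing at both ends, divided by `φ`: it is bounded when the
tails of `φ` are controlled by `φ`. -/
lemma exists_bounded_quotient_primitive {H φ ψ f : ℝ → ℝ} {C M : ℝ}
    (hpos : ∀ t, 0 < φ t) (hH : ∀ t, HasDerivAt H (φ t) t) (hφ : ∀ t, HasDerivAt φ (ψ t) t)
    (hHb : ∀ t, |H t| ≤ 1)
    (htop : Tendsto H atTop (nhds 1)) (hbot : Tendsto H atBot (nhds (-1)))
    (hr : ∀ t, 0 ≤ t → 1 - H t ≤ C * φ t) (hl : ∀ t, t ≤ 0 → H t + 1 ≤ C * φ t)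
    (hf : Continuous f) (hfM : ∀ t, |f t| ≤ M) (horth : ∫ t, f t * φ t = 0) :
    ∃ P : ℝ → ℝ, (∀ t, HasDerivAt P (f t - ψ t / φ t * P t) t) ∧ ∀ t, |P t| ≤ M * C := by
  have hcφ : Continuous φ := continuous_iff_continuousAt.2 fun t => (hφ t).continuousAt
  have hM : 0 ≤ M := (abs_nonneg _).trans (hfM 0)
  have hint : Integrable φ := by
    refine integrable_of_intervalIntegral_norm_bounded (l := atTop) (a := fun x : ℝ => -x)
      (b := fun x : ℝ => x) 2 (fun x => (hcφ.integrableOn_Icc).mono_set Set.Ioc_subset_Icc_self)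
      tendsto_neg_atTop_atBot tendsto_id (Eventually.of_forall fun x => ?_)
    have h1 : ∀ t, ‖φ t‖ = φ t := fun t => Real.norm_of_nonneg (hpos t).le
    simp only [h1]
    rw [intervalIntegral.integral_eq_sub_of_hasDerivAt (fun t _ => hH t)
      (hcφ.intervalIntegrable _ _)]
    linarith [abs_le.1 (hHb x), abs_le.1 (hHb (-x))]
  have hfφ : Integrable (fun t => f t * φ t) :=
    hint.bdd_mul hf.aestronglyMeasurable (Eventually.of_forall fun t => hfM t)
  set Q : ℝ → ℝ := fun t => ∫ s in Set.Iic t, f s * φ s with hQ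
  have hQd : ∀ t, HasDerivAt Q (f t * φ t) t := by
    intro t
    have h1 : Q = fun t => Q 0 + ∫ s in (0 : ℝ)..t, f s * φ s := by
      funext x
      rw [← intervalIntegral.integral_Iic_sub_Iic hfφ.integrableOn hfφ.integrableOn]
      simp [hQ]
    rw [h1]
    exact ((hf.mul hcφ).integral_hasStrictDerivAt 0 t).hasDerivAt.const_add _
  have hbound : ∀ s : Set ℝ, |∫ t in s, f t * φ t| ≤ M * ∫ t in s, φ t := by
    intro s
    rw [← integral_const_mul, ← Real.norm_eq_abs]
    refine norm_integral_le_of_norm_le (hint.integrableOn.const_mul M)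
      (Eventually.of_forall fun t => ?_)
    rw [Real.norm_eq_abs, abs_mul, abs_of_pos (hpos t)]
    exact mul_le_mul_of_nonneg_right (hfM t) (hpos t).le
  have hQb : ∀ t, |Q t| ≤ M * C * φ t := by
    intro t
    rcases le_total t 0 with ht | ht
    · have h1 := hbound (Set.Iic t)
      rw [integral_Iic_of_hasDerivAt_of_tendsto (hH t).continuousAt.continuousWithinAt
        (fun x _ => hH x) hint.integrableOn hbot] at h1
      calc |Q t| ≤ M * (H t - -1) := h1
        _ ≤ M * (C * φ t) := by
          have := hl t ht
          gcongr
          linarith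
        _ = M * C * φ t := by ring
    · have h1 := hbound (Set.Ioi t)
      rw [integral_Ioi_of_hasDerivAt_of_tendsto (hH t).continuousAt.continuousWithinAt
        (fun x _ => hH x) hint.integrableOn htop] at h1
      have h2 := integral_add_compl (measurableSet_Iic (a := t)) hfφ
      rw [horth, Set.compl_Iic] at h2
      have h3 : Q t = -∫ s in Set.Ioi t, f s * φ s := by linarith
      rw [h3, abs_neg]
      calc _ ≤ M * (1 - H t) := h1
        _ ≤ M * (C * φ t) := by
          have := hr t ht
          gcongr
        _ = M * C * φ t := by ring
  refine ⟨fun t => Q t / φ t, fun t => ?_, fun t => ?_⟩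
  · have hne := (hpos t).ne'
    exact ((hQd t).div (hφ t) hne).congr_deriv (by field_simp)
  · rw [abs_div, abs_of_pos (hpos t), div_le_iff₀ (hpos t)]
    exact hQb t

/-- A nonnegative `C¹` bump function supported in `[-R, R]`. -/
noncomputable def bump (R z : ℝ) : ℝ := (1 - z ^ 2 / R ^ 2) ^ 2

/-- The derivative of `bump R`. -/
noncomputable def bump' (R z : ℝ) : ℝ := -(4 * z / R ^ 2) * (1 - z ^ 2 / R ^ 2)

/-- The second derivative of `bump R`. -/
noncomputable def bump'' (R z : ℝ) : ℝ :=
  -(4 / R ^ 2) * (1 - z ^ 2 / R ^ 2) + 8 * z ^ 2 / R ^ 4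

lemma hasDerivAt_bump_base (R z : ℝ) :
    HasDerivAt (fun z => 1 - z ^ 2 / R ^ 2) (-(2 * z / R ^ 2)) z := by
  have := (((hasDerivAt_id z).fun_pow 2).div_const (R ^ 2)).const_sub 1
  exact this.congr_deriv (by simp)

lemma hasDerivAt_bump (R z : ℝ) : HasDerivAt (bump R) (bump' R z) z :=
  ((hasDerivAt_bump_base R z).fun_pow 2).congr_deriv (by simp [bump']; ring)

lemma hasDerivAt_bump' (R z : ℝ) : HasDerivAt (bump' R) (bump'' R z) z := by
  have h : HasDerivAt (fun z => -(4 * z / R ^ 2)) (-(4 * 1 / R ^ 2)) z :=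
    (((hasDerivAt_id z).const_mul 4).div_const (R ^ 2)).neg
  exact (h.mul (hasDerivAt_bump_base R z)).congr_deriv (by
    simp only [bump'']
    ring)

lemma bump_nonneg (R z : ℝ) : 0 ≤ bump R z := sq_nonneg _

lemma continuous_bump (R : ℝ) : Continuous (bump R) := by
  unfold bump
  fun_prop

lemma continuous_bump'' (R : ℝ) : Continuous (bump'' R) := by
  unfold bump''
  fun_prop

lemma bump_base_mem {R z : ℝ} (hR : 0 < R) (hz : z ∈ Set.Icc (-R) R) :
    0 ≤ 1 - z ^ 2 / R ^ 2 ∧ 1 - z ^ 2 / R ^ 2 ≤ 1 := by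
  have h1 : z ^ 2 ≤ R ^ 2 := sq_le_sq' hz.1 hz.2
  have h2 : z ^ 2 / R ^ 2 ≤ 1 := (div_le_one (by positivity)).2 h1
  have h3 : 0 ≤ z ^ 2 / R ^ 2 := by positivity
  constructor <;> linarith

lemma abs_bump'_le {R δ z : ℝ} (hδ : 0 < δ) (hR0 : 0 < R) (hR : 4 / δ ^ 2 ≤ R)
    (hz : z ∈ Set.Icc (-R) R) : |bump' R z| ≤ δ * (bump R z + 1 / R) := by
  obtain ⟨h0, h1⟩ := bump_base_mem hR0 hz
  have hzR : |z| ≤ R := abs_le.2 hz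
  simp only [bump, bump']
  set s := 1 - z ^ 2 / R ^ 2
  have h2 : |-(4 * z / R ^ 2) * s| ≤ 4 / R * s := by
    rw [abs_mul, abs_neg, abs_div, abs_mul, abs_of_nonneg h0, abs_of_pos (by positivity : 0 < R ^ 2),
      abs_of_pos (by norm_num : (0 : ℝ) < 4)]
    refine mul_le_mul_of_nonneg_right ?_ h0
    rw [div_le_div_iff₀ (by positivity) hR0]
    nlinarith
  refine h2.trans ?_
  rw [div_le_iff₀ (by positivity)] at hR
  have h3 : δ * (s ^ 2 + 1 / R) - 4 / R * s
      = (1 / (δ * R ^ 2)) * ((δ * R * s - 2) ^ 2 + (R * δ ^ 2 - 4)) := by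
    field_simp
    ring
  have h4 : 0 ≤ (1 / (δ * R ^ 2)) * ((δ * R * s - 2) ^ 2 + (R * δ ^ 2 - 4)) :=
    mul_nonneg (by positivity) (by nlinarith [sq_nonneg (δ * R * s - 2)])
  linarith

lemma abs_bump''_le {R δ z : ℝ} (hδ : 0 < δ) (hR0 : 0 < R) (hR : 8 / δ ≤ R)
    (hz : z ∈ Set.Icc (-R) R) : |bump'' R z| ≤ δ / R := by
  obtain ⟨h0, h1⟩ := bump_base_mem hR0 hz
  have h2 : bump'' R z = (8 - 12 * (1 - z ^ 2 / R ^ 2)) / R ^ 2 := by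
    unfold bump''
    field_simp
    ring
  rw [div_le_iff₀ hδ] at hR
  rw [h2, abs_div, abs_of_pos (by positivity : 0 < R ^ 2), div_le_div_iff₀ (by positivity) hR0]
  have h3 : |8 - 12 * (1 - z ^ 2 / R ^ 2)| ≤ 8 := abs_le.2 ⟨by linarith, by linarith⟩
  nlinarith

/-- The pointwise inequality behind the coercivity estimate `exists_bump_coercivity`; the term
in square brackets is a total derivative. -/
lemma coercivity_pointwise {c T Λ δ r B M V f f₁ f₂ q P θ ζ ζ₁ ζ₂ : ℝ}
    (hc : 0 < c) (hT : 0 ≤ T) (hcT : 8 * c * T ^ 2 = 1) (hr : 0 ≤ r)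
    (hζ : 0 ≤ ζ) (hζ₁ : |ζ₁| ≤ δ * (ζ + r)) (hζ₂ : |ζ₂| ≤ δ * r)
    (hq : |q| ≤ Λ) (hθ : |θ| ≤ T) (hf : |f| ≤ M) (hP : |P| ≤ B) (hδ : 0 ≤ δ)
    (hδ₁ : δ * (Λ + c + 4 * c ^ 2 * T) ≤ c / 2) (hδ₂ : δ * (Λ + c + 4 * c ^ 2 * T) ≤ c ^ 2) :
    c / 2 * (ζ * f ^ 2) ≤ ζ * (f * (V * f - f₂)) +
      (ζ₁ * f * f₁ + ζ * f₁ ^ 2 + ζ * f * f₂ - ζ₂ * f ^ 2 / 2 - ζ₁ * f * f₁ - ζ₁ * q * f ^ 2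
        - ζ * (V - q ^ 2) * f ^ 2 - 2 * ζ * q * f * f₁
        + 2 * c * (ζ₁ * f * P + ζ * f₁ * P + ζ * f * (f - q * P))
        + 4 * c ^ 2 * (ζ₁ * θ * P ^ 2 + ζ * (1 + 2 * q * θ) * P ^ 2
          + 2 * ζ * θ * P * (f - q * P)))
      + δ * r * ((Λ + c + 4 * c ^ 2 * T + 1) * (M ^ 2 + B ^ 2)) := by
  set L := Λ + c + 4 * c ^ 2 * T with hL
  have hΛ : 0 ≤ Λ := (abs_nonneg _).trans hq
  have hL0 : 0 ≤ L := by positivity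
  have hf2 : f ^ 2 ≤ M ^ 2 := by
    rw [← sq_abs]
    exact pow_le_pow_left₀ (abs_nonneg _) hf 2
  have hP2 : P ^ 2 ≤ B ^ 2 := by
    rw [← sq_abs]
    exact pow_le_pow_left₀ (abs_nonneg _) hP 2
  have hθ2 : θ ^ 2 ≤ T ^ 2 := by
    rw [← sq_abs]
    exact pow_le_pow_left₀ (abs_nonneg _) hθ 2
  -- the cross term with `θ`
  have h1 : -(2 * c ^ 2 * P ^ 2 + c * f ^ 2) ≤ 8 * c ^ 2 * θ * P * f := by
    have e1 : 0 ≤ 2 * c ^ 2 * (P + 2 * θ * f) ^ 2 := by positivity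
    have e2 : 8 * c ^ 2 * θ ^ 2 * f ^ 2 ≤ c * f ^ 2 := by
      have e3 : c * f ^ 2 = 8 * c ^ 2 * T ^ 2 * f ^ 2 := by
        linear_combination (-(c * f ^ 2)) * hcT
      rw [e3]
      gcongr
    nlinarith
  -- the terms containing the first derivative of the cutoff
  have h2 : |-(q * f ^ 2) + 2 * c * f * P + 4 * c ^ 2 * θ * P ^ 2| ≤ L * (f ^ 2 + P ^ 2) := by
    have e1 : |-(q * f ^ 2)| ≤ Λ * f ^ 2 := by
      rw [abs_neg, abs_mul, abs_of_nonneg (sq_nonneg f)]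
      gcongr
    have e2 : |2 * c * f * P| ≤ c * (f ^ 2 + P ^ 2) := by
      rw [abs_le]
      constructor <;> nlinarith [mul_nonneg hc.le (sq_nonneg (f + P)),
        mul_nonneg hc.le (sq_nonneg (f - P))]
    have e3 : |4 * c ^ 2 * θ * P ^ 2| ≤ 4 * c ^ 2 * T * P ^ 2 := by
      rw [abs_mul, abs_mul, abs_of_nonneg (sq_nonneg P),
        abs_of_nonneg (by positivity : 0 ≤ 4 * c ^ 2)]
      gcongr
    have e4 := abs_add_three (-(q * f ^ 2)) (2 * c * f * P) (4 * c ^ 2 * θ * P ^ 2)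
    have e5 : 0 ≤ Λ * P ^ 2 := by positivity
    have e6 : 0 ≤ 4 * c ^ 2 * T * f ^ 2 := by positivity
    rw [hL]
    linarith
  have h3 : -(δ * (ζ + r) * (L * (f ^ 2 + P ^ 2)))
      ≤ ζ₁ * (-(q * f ^ 2) + 2 * c * f * P + 4 * c ^ 2 * θ * P ^ 2) := by
    have e1 : |ζ₁ * (-(q * f ^ 2) + 2 * c * f * P + 4 * c ^ 2 * θ * P ^ 2)|
        ≤ δ * (ζ + r) * (L * (f ^ 2 + P ^ 2)) := by
      rw [abs_mul]
      exact mul_le_mul hζ₁ h2 (abs_nonneg _) (by positivity)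
    exact (abs_le.1 e1).1
  have h4 : ζ₂ * f ^ 2 / 2 ≤ δ * r * f ^ 2 / 2 := by
    have := (abs_le.1 hζ₂).2
    gcongr
  have h5 : δ * r * (L * (f ^ 2 + P ^ 2)) + δ * r * f ^ 2 / 2
      ≤ δ * r * ((L + 1) * (M ^ 2 + B ^ 2)) := by
    have e1 : L * (f ^ 2 + P ^ 2) + f ^ 2 / 2 ≤ (L + 1) * (M ^ 2 + B ^ 2) := by
      nlinarith [mul_le_mul_of_nonneg_left (add_le_add hf2 hP2) hL0, sq_nonneg f, sq_nonneg B]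
    have := mul_le_mul_of_nonneg_left e1 (mul_nonneg hδ hr)
    linarith
  have h6 : δ * L * (ζ * f ^ 2) ≤ c / 2 * (ζ * f ^ 2) :=
    mul_le_mul_of_nonneg_right hδ₁ (by positivity)
  have h7 : δ * L * (ζ * P ^ 2) ≤ c ^ 2 * (ζ * P ^ 2) :=
    mul_le_mul_of_nonneg_right hδ₂ (by positivity)
  have h8 := mul_le_mul_of_nonneg_left h1 hζ
  have h9 : 0 ≤ ζ * (f₁ - q * f + c * P) ^ 2 := by positivity
  linarith

set_option maxHeartbeats 2000000 in
/-- Coercivity, up to a small error, of the quadratic form of `-∂² + V` with weight `bump R` on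
bounded functions orthogonal to the positive solution `φ` of `φ'' = V φ`. -/
lemma exists_bump_coercivity {H φ ψ V : ℝ → ℝ} {a R₁ Λ : ℝ} (ha : 0 < a) (hΛ : 0 ≤ Λ)
    (hpos : ∀ t, 0 < φ t) (hH : ∀ t, HasDerivAt H (φ t) t) (hφ : ∀ t, HasDerivAt φ (ψ t) t)
    (hψ : ∀ t, HasDerivAt ψ (V t * φ t) t) (hHb : ∀ t, |H t| ≤ 1) (hVc : Continuous V)
    (hVΛ : ∀ t, V t ≤ Λ ^ 2) (hV : ∀ t, R₁ ≤ |t| → a ^ 2 ≤ V t)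
    (htop : Tendsto H atTop (nhds 1)) (hbot : Tendsto H atBot (nhds (-1))) :
    ∃ c : ℝ, 0 < c ∧ ∀ M ε : ℝ, 0 < ε → ∃ R₀ : ℝ, 0 < R₀ ∧ ∀ R, R₀ ≤ R →
      ∀ f f₁ f₂ : ℝ → ℝ, (∀ t, HasDerivAt f (f₁ t) t) → (∀ t, HasDerivAt f₁ (f₂ t) t) →
        Continuous f₂ → (∀ t, |f t| ≤ M) → ∫ t, f t * φ t = 0 →
        c * ∫ t in -R..R, bump R t * f t ^ 2 ≤
          (∫ t in -R..R, bump R t * (f t * (V t * f t - f₂ t))) + ε := by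
  have hcφ : Continuous φ := continuous_iff_continuousAt.2 fun t => (hφ t).continuousAt
  obtain ⟨Cr, hCr⟩ := exists_right_tail_bounds (R := R₁) ha hpos hH hφ hψ hHb
    (fun t ht => hV t (ht.trans (le_abs_self t))) htop
  obtain ⟨Cl, hCl⟩ := exists_left_tail_bounds (R := R₁) ha hpos hH hφ hψ hHb
    (fun t ht => hV t (by linarith [neg_le_abs t])) hbot
  set C := |Cr| + |Cl| with hC
  have hCrC : Cr ≤ C := by linarith [le_abs_self Cr, abs_nonneg Cl]
  have hClC : Cl ≤ C := by linarith [le_abs_self Cl, abs_nonneg Cr]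
  set T := C + 1 with hT
  have hT0 : 0 < T := by positivity
  set θ : ℝ → ℝ := fun t => φ t ^ 2 * ∫ s in (0 : ℝ)..t, (φ s ^ 2)⁻¹ with hθdef
  have hθT : ∀ t, |θ t| ≤ T := by
    intro t
    rcases le_total 0 t with ht | ht
    · linarith [(hCr t ht).2]
    · linarith [(hCl t ht).2]
  set q : ℝ → ℝ := fun t => ψ t / φ t with hqdef
  have hqd : ∀ t, HasDerivAt q (V t - q t ^ 2) t := fun t =>
    ((hψ t).div (hφ t) (hpos t).ne').congr_deriv (by
      have := (hpos t).ne'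
      simp only [hqdef]
      field_simp)
  have hθd : ∀ t, HasDerivAt θ (1 + 2 * q t * θ t) t := fun t =>
    (((hφ t).fun_pow 2).mul (hasDerivAt_integral_inv_sq hpos hcφ t)).congr_deriv (by
      have := (hpos t).ne'
      simp only [hqdef, hθdef]
      field_simp
      norm_num
      ring)
  have hqΛ : ∀ t, |q t| ≤ Λ := by
    intro t
    have h1 := deriv_le_mul_of_pos_solution hΛ hpos hφ hψ hVΛ t
    have hneg : ∀ {g g' : ℝ → ℝ}, (∀ t, HasDerivAt g (g' t) t) →
        ∀ t, HasDerivAt (fun t => g (-t)) (-g' (-t)) t := fun h t =>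
      ((h (-t)).comp t (hasDerivAt_neg t)).congr_deriv (by ring)
    have h2 := deriv_le_mul_of_pos_solution (φ := fun t => φ (-t)) (ψ := fun t => -ψ (-t))
      (V := fun t => V (-t)) hΛ (fun t => hpos _) (hneg hφ)
      (fun t => ((hneg hψ t).neg).congr_deriv (by ring)) (fun t => hVΛ _) (-t)
    simp only [neg_neg] at h2
    rw [hqdef, abs_div, abs_of_pos (hpos t), div_le_iff₀ (hpos t), abs_le]
    constructor <;> linarith
  set c := 1 / (8 * T ^ 2) with hcdef
  have hc : 0 < c := by positivity
  have hcT : 8 * c * T ^ 2 = 1 := by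
    rw [hcdef]
    field_simp
  set L := Λ + c + 4 * c ^ 2 * T with hL
  have hL0 : 0 < L := by positivity
  refine ⟨c / 2, by positivity, fun M ε hε => ?_⟩
  set K := (L + 1) * (M ^ 2 + (M * C) ^ 2) + 1 with hK
  have hK0 : 0 < K := by positivity
  set δ := min (min (c / 2 / L) (c ^ 2 / L)) (ε / (2 * K)) with hδdef
  have hδ : 0 < δ := by positivity
  have hδ₁ : δ * L ≤ c / 2 := by
    rw [← le_div_iff₀ hL0]
    exact (min_le_left _ _).trans (min_le_left _ _)
  have hδ₂ : δ * L ≤ c ^ 2 := by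
    rw [← le_div_iff₀ hL0]
    exact (min_le_left _ _).trans (min_le_right _ _)
  have hδ₃ : δ * (2 * K) ≤ ε := by
    rw [← le_div_iff₀ (by positivity)]
    exact min_le_right _ _
  refine ⟨4 / δ ^ 2 + 8 / δ, by positivity, fun R hR f f₁ f₂ hf hf₁ hf₂ hfM horth => ?_⟩
  have p1 : 0 < 4 / δ ^ 2 := by positivity
  have p2 : 0 < 8 / δ := by positivity
  have hR0 : 0 < R := by linarith
  have hcf : Continuous f := continuous_iff_continuousAt.2 fun t => (hf t).continuousAt
  have hcf₁ : Continuous f₁ := continuous_iff_continuousAt.2 fun t => (hf₁ t).continuousAt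
  obtain ⟨P, hPd, hPb⟩ := exists_bounded_quotient_primitive (C := C) hpos hH hφ hHb htop hbot
    (fun t ht => (hCr t ht).1.trans (mul_le_mul_of_nonneg_right hCrC (hpos t).le))
    (fun t ht => (hCl t ht).1.trans (mul_le_mul_of_nonneg_right hClC (hpos t).le))
    hcf hfM horth
  have hcP : Continuous P := continuous_iff_continuousAt.2 fun t => (hPd t).continuousAt
  have hcq : Continuous q := continuous_iff_continuousAt.2 fun t => (hqd t).continuousAt
  have hcθ : Continuous θ := continuous_iff_continuousAt.2 fun t => (hθd t).continuousAt
  have hcb := continuous_bump R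
  have hcb' : Continuous (bump' R) :=
    continuous_iff_continuousAt.2 fun t => (hasDerivAt_bump' R t).continuousAt
  have hcb'' := continuous_bump'' R
  set U : ℝ → ℝ := fun t => bump R t * f t * f₁ t - bump' R t * f t ^ 2 / 2
    - bump R t * q t * f t ^ 2 + 2 * c * (bump R t * f t * P t)
    + 4 * c ^ 2 * (bump R t * θ t * P t ^ 2) with hU
  set u : ℝ → ℝ := fun t => bump' R t * f t * f₁ t + bump R t * f₁ t ^ 2 + bump R t * f t * f₂ t
    - bump'' R t * f t ^ 2 / 2 - bump' R t * f t * f₁ t - bump' R t * q t * f t ^ 2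
    - bump R t * (V t - q t ^ 2) * f t ^ 2 - 2 * bump R t * q t * f t * f₁ t
    + 2 * c * (bump' R t * f t * P t + bump R t * f₁ t * P t
      + bump R t * f t * (f t - q t * P t))
    + 4 * c ^ 2 * (bump' R t * θ t * P t ^ 2 + bump R t * (1 + 2 * q t * θ t) * P t ^ 2
      + 2 * bump R t * θ t * P t * (f t - q t * P t)) with hu
  have hUd : ∀ t, HasDerivAt U (u t) t := by
    intro t
    have hb := hasDerivAt_bump R t
    have hb' := hasDerivAt_bump' R t
    have hf2 := (hf t).fun_pow 2
    have hP2 := (hPd t).fun_pow 2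
    refine (((((hb.fun_mul (hf t)).fun_mul (hf₁ t)).fun_sub
      ((hb'.fun_mul hf2).div_const 2)).fun_sub ((hb.fun_mul (hqd t)).fun_mul hf2)).fun_add
      (((hb.fun_mul (hf t)).fun_mul (hPd t)).const_mul (2 * c))).fun_add
      (((hb.fun_mul (hθd t)).fun_mul hP2).const_mul (4 * c ^ 2)) |>.congr_deriv ?_
    simp only [hu, hqdef]
    norm_num
    ring
  have hcu : Continuous u := by
    simp only [hu]
    fun_prop
  have hbR : bump R R = 0 := by simp [bump, hR0.ne']
  have hbR' : bump R (-R) = 0 := by simp [bump, hR0.ne']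
  have hb'R : bump' R R = 0 := by simp [bump', hR0.ne']
  have hb'R' : bump' R (-R) = 0 := by simp [bump', hR0.ne']
  have hintu : ∫ t in -R..R, u t = 0 := by
    rw [intervalIntegral.integral_eq_sub_of_hasDerivAt (fun t _ => hUd t)
      (hcu.intervalIntegrable _ _)]
    simp [hU, hbR, hbR', hb'R, hb'R']
  have hmono := intervalIntegral.integral_mono_on (μ := volume) (a := -R) (b := R)
    (f := fun t => c / 2 * (bump R t * f t ^ 2))
    (g := fun t => bump R t * (f t * (V t * f t - f₂ t)) + u t
      + δ * (1 / R) * ((L + 1) * (M ^ 2 + (M * C) ^ 2)))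
    (by linarith) (Continuous.intervalIntegrable (by fun_prop) _ _)
    (Continuous.intervalIntegrable (by fun_prop) _ _)
    (fun t ht => coercivity_pointwise hc hT0.le hcT (by positivity) (bump_nonneg R t)
      (abs_bump'_le hδ hR0 (by linarith) ht)
      ((abs_bump''_le hδ hR0 (by linarith) ht).trans_eq (by ring)) (hqΛ t) (hθT t) (hfM t)
      (hPb t) hδ.le hδ₁ hδ₂)
  rw [intervalIntegral.integral_add (Continuous.intervalIntegrable (by fun_prop) _ _)
    (Continuous.intervalIntegrable (by fun_prop) _ _),
    intervalIntegral.integral_add (Continuous.intervalIntegrable (by fun_prop) _ _)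
    (hcu.intervalIntegrable _ _), hintu, intervalIntegral.integral_const_mul,
    intervalIntegral.integral_const] at hmono
  refine hmono.trans ?_
  have hfin : (R - -R) • (δ * (1 / R) * ((L + 1) * (M ^ 2 + (M * C) ^ 2)))
      = δ * (2 * (K - 1)) := by
    rw [smul_eq_mul, hK]
    field_simp
    ring
  rw [hfin]
  nlinarith

/-- Differentiation under the integral sign over a compact interval. -/
lemma hasDerivAt_intervalIntegral_of_continuous {F F' : ℝ → ℝ → ℝ} {a b : ℝ}
    (hF : Continuous (Function.uncurry F)) (hF' : Continuous (Function.uncurry F'))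
    (hd : ∀ t z, HasDerivAt (fun t => F t z) (F' t z) t) (t₀ : ℝ) :
    HasDerivAt (fun t => ∫ z in a..b, F t z) (∫ z in a..b, F' t₀ z) t₀ := by
  obtain ⟨C, hC⟩ := ((isCompact_Icc (a := t₀ - 1) (b := t₀ + 1)).prod
    (isCompact_uIcc (a := a) (b := b))).exists_bound_of_continuousOn hF'.continuousOn
  have hcF : ∀ t, Continuous (F t) := fun t => hF.comp (Continuous.prodMk_right t)
  have hcF' : ∀ t, Continuous (F' t) := fun t => hF'.comp (Continuous.prodMk_right t)
  refine (intervalIntegral.hasDerivAt_integral_of_dominated_loc_of_deriv_le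
    (bound := fun _ => C) (F := F) (F' := F')
    (Icc_mem_nhds (by linarith : t₀ - 1 < t₀) (by linarith : t₀ < t₀ + 1))
    (Eventually.of_forall fun t => (hcF t).aestronglyMeasurable)
    ((hcF t₀).intervalIntegrable _ _) (hcF' t₀).aestronglyMeasurable
    (Eventually.of_forall fun z hz t ht => hC (t, z) ⟨ht, Set.uIoc_subset_uIcc hz⟩)
    (continuous_const.intervalIntegrable _ _)
    (Eventually.of_forall fun z _ t _ => hd t z)).2

/-- The second derivative is nonpositive at a global maximum. -/
lemma second_deriv_nonpos_of_forall_le {g g' : ℝ → ℝ} {d t₀ : ℝ}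
    (hg : ∀ t, HasDerivAt g (g' t) t) (hg' : HasDerivAt g' d t₀) (hmax : ∀ t, g t ≤ g t₀) :
    d ≤ 0 := by
  by_contra! hd
  have hderiv : deriv g = g' := funext fun t => (hg t).deriv
  have hlocmax : IsLocalMax g t₀ := Eventually.of_forall hmax
  have hlocmin : IsLocalMin g t₀ := isLocalMin_of_deriv_deriv_pos
    (by rw [hderiv, hg'.deriv]; exact hd) hlocmax.deriv_eq_zero (hg t₀).continuousAt
  have hconst : g =ᶠ[nhds t₀] fun _ => g t₀ := by
    filter_upwards [hlocmin] with t ht using le_antisymm (hmax t) ht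
  have h1 : g' =ᶠ[nhds t₀] fun _ => 0 := by
    have := hconst.deriv
    rw [hderiv] at this
    simpa using this
  have h2 := h1.deriv_eq
  rw [hg'.deriv, deriv_const] at h2
  linarith

/-- A maximum principle on `ℝ^k`: if `h` is bounded above and `c h ≤ ε + Δ h`, then `c h ≤ ε`.
Here `D i y` stands for the second derivative of `h` at `y` in the `i`-th coordinate. -/
lemma mul_le_of_le_add_laplacian {k : ℕ} {h : (Fin k → ℝ) → ℝ} {D : (Fin k → ℝ) → Fin k → ℝ}
    {K c ε : ℝ} (hc : 0 < c) (hcont : Continuous h) (hK : ∀ y, h y ≤ K)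
    (hD : ∀ y i, ∃ g' : ℝ → ℝ, (∀ t, HasDerivAt (fun t => h (Function.update y i t)) (g' t) t) ∧
      HasDerivAt g' (D y i) (y i))
    (hineq : ∀ y, c * h y ≤ ε + ∑ i, D y i) (y : Fin k → ℝ) : c * h y ≤ ε := by
  have key : ∀ σ : ℝ, 0 < σ → c * h y ≤ ε + σ * (2 * k + c * ∑ i, y i ^ 2) := by
    intro σ hσ
    have hlim : Tendsto (fun x : Fin k → ℝ => σ * ∑ i, x i ^ 2 - h x)
        (cocompact (Fin k → ℝ)) atTop := by
      have h1 : Tendsto (fun x : Fin k → ℝ => σ * ‖x‖ ^ 2 + -K)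
          (cocompact (Fin k → ℝ)) atTop :=
        tendsto_atTop_add_const_right _ _ (Tendsto.const_mul_atTop hσ
          ((tendsto_pow_atTop two_ne_zero).comp (tendsto_norm_cocompact_atTop (E := Fin k → ℝ))))
      refine tendsto_atTop_mono (fun x => ?_) h1
      have h2 : ‖x‖ ^ 2 ≤ ∑ i, x i ^ 2 := by
        have h3 : ‖x‖ ≤ Real.sqrt (∑ i, x i ^ 2) := by
          refine (pi_norm_le_iff_of_nonneg (Real.sqrt_nonneg _)).2 fun i => ?_
          rw [Real.norm_eq_abs]
          exact Real.abs_le_sqrt (Finset.single_le_sum (f := fun i => x i ^ 2)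
            (fun j _ => sq_nonneg _) (Finset.mem_univ i))
        calc ‖x‖ ^ 2 ≤ Real.sqrt (∑ i, x i ^ 2) ^ 2 := pow_le_pow_left₀ (norm_nonneg _) h3 2
          _ = _ := Real.sq_sqrt (Finset.sum_nonneg fun i _ => sq_nonneg _)
      nlinarith [hK x]
    obtain ⟨x, hx⟩ := Continuous.exists_forall_le (by fun_prop) hlim
    have hDx : ∀ i, D x i ≤ 2 * σ := by
      intro i
      obtain ⟨g', hg, hg'⟩ := hD x i
      have hsq : ∀ t, HasDerivAt (fun t : ℝ => σ * t ^ 2) (σ * (2 * t)) t := fun t =>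
        ((hasDerivAt_pow 2 t).const_mul σ).congr_deriv (by norm_num)
      have hlin : HasDerivAt (fun t : ℝ => σ * (2 * t)) (σ * (2 * 1)) (x i) :=
        ((hasDerivAt_id (x i)).const_mul 2).const_mul σ
      have := second_deriv_nonpos_of_forall_le (fun t => (hg t).fun_sub (hsq t))
        (hg'.fun_sub hlin) (fun t => by
          have h1 := hx (Function.update x i t)
          have h2 : ∑ j, (Function.update x i t) j ^ 2 - ∑ j, x j ^ 2 = t ^ 2 - x i ^ 2 := by
            rw [← Finset.sum_sub_distrib, Finset.sum_eq_single i]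
            · simp
            · intro j _ hj
              simp [hj]
            · simp
          have h3 : σ * ∑ j, (Function.update x i t) j ^ 2
              = σ * ∑ j, x j ^ 2 + σ * t ^ 2 - σ * x i ^ 2 := by
            linear_combination σ * h2
          simp only [Function.update_eq_self]
          linarith)
      linarith
    have hsum : ∑ i, D x i ≤ k * (2 * σ) := by
      simpa using Finset.sum_le_card_nsmul Finset.univ (fun i => D x i) (2 * σ) fun i _ => hDx i
    have h0 : 0 ≤ σ * ∑ i, x i ^ 2 :=
      mul_nonneg hσ.le (Finset.sum_nonneg fun i _ => sq_nonneg _)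
    have h1 : h y ≤ h x + σ * ∑ i, y i ^ 2 := by linarith [hx y]
    have h2 := mul_le_mul_of_nonneg_left h1 hc.le
    linarith [hineq x]
  set N := 2 * k + c * ∑ i, y i ^ 2 with hN
  have hN0 : 0 ≤ N := by
    have : 0 ≤ ∑ i, y i ^ 2 := Finset.sum_nonneg fun i _ => sq_nonneg _
    positivity
  refine le_of_forall_pos_le_add fun η hη => ?_
  refine (key (η / (N + 1)) (by positivity)).trans ?_
  have h1 : η / (N + 1) * N ≤ η := by
    rw [div_mul_eq_mul_div, div_le_iff₀ (by positivity)]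
    nlinarith
  linarith

lemma hasDerivAt_fst_of_differentiable {g : ℝ × ℝ → ℝ} (hg : Differentiable ℝ g) (t z : ℝ) :
    HasDerivAt (fun t => g (t, z)) (fderiv ℝ g (t, z) (1, 0)) t :=
  (hg (t, z)).hasFDerivAt.comp_hasDerivAt t ((hasDerivAt_id t).prodMk (hasDerivAt_const t z))

/-- The weighted `L²` energy of a `C²` family of functions is twice differentiable in the
parameter, and its second derivative dominates the integral of the weight against
`2 G ∂²G`. -/
lemma exists_second_deriv_weighted_energy {G : ℝ → ℝ → ℝ} {ζ : ℝ → ℝ} {a b : ℝ} (hab : a ≤ b)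
    (hG : ContDiff ℝ 2 (fun p : ℝ × ℝ => G p.1 p.2)) (hζ : Continuous ζ) (hζ0 : ∀ z, 0 ≤ ζ z)
    (t₀ : ℝ) :
    Continuous (fun z => iteratedDeriv 2 (fun t => G t z) t₀) ∧
    ∃ d : ℝ, (∃ g' : ℝ → ℝ, (∀ t, HasDerivAt (fun t => ∫ z in a..b, ζ z * G t z ^ 2) (g' t) t) ∧
      HasDerivAt g' d t₀) ∧
      ∫ z in a..b, ζ z * (2 * (G t₀ z * iteratedDeriv 2 (fun t => G t z) t₀)) ≤ d := by
  set g : ℝ × ℝ → ℝ := fun p => G p.1 p.2 with hgdef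
  set g₁ : ℝ × ℝ → ℝ := fun p => fderiv ℝ g p (1, 0) with hg₁def
  set g₂ : ℝ × ℝ → ℝ := fun p => fderiv ℝ g₁ p (1, 0) with hg₂def
  have hg₁ : ContDiff ℝ 1 g₁ :=
    (hG.fderiv_right (m := 1) (by norm_num)).clm_apply contDiff_const
  have hg₂ : Continuous g₂ :=
    ((hg₁.fderiv_right (m := 0) (by norm_num)).clm_apply contDiff_const).continuous
  have hd₁ : ∀ t z, HasDerivAt (fun t => G t z) (g₁ (t, z)) t :=
    hasDerivAt_fst_of_differentiable (hG.differentiable (by norm_num))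
  have hd₂ : ∀ t z, HasDerivAt (fun t => g₁ (t, z)) (g₂ (t, z)) t :=
    hasDerivAt_fst_of_differentiable (hg₁.differentiable (by norm_num))
  have hit : ∀ z, iteratedDeriv 2 (fun t => G t z) t₀ = g₂ (t₀, z) := by
    intro z
    rw [iteratedDeriv_succ, iteratedDeriv_one, funext fun t => (hd₁ t z).deriv]
    exact (hd₂ t₀ z).deriv
  have hcg : Continuous g := hG.continuous
  have hcg₁ : Continuous g₁ := hg₁.continuous
  have hcG : Continuous fun p : ℝ × ℝ => G p.1 p.2 := hcg
  simp only [hit]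
  refine ⟨by fun_prop, ∫ z in a..b, ζ z * (2 * (g₁ (t₀, z) ^ 2 + G t₀ z * g₂ (t₀, z))),
    ⟨fun t => ∫ z in a..b, ζ z * (2 * (G t z * g₁ (t, z))), ?_, ?_⟩, ?_⟩
  · refine hasDerivAt_intervalIntegral_of_continuous (F := fun t z => ζ z * G t z ^ 2)
      (F' := fun t z => ζ z * (2 * (G t z * g₁ (t, z)))) ?_ ?_ fun t z => ?_
    · simp only [Function.uncurry_def]
      fun_prop
    · simp only [Function.uncurry_def]
      fun_prop
    · exact (((hd₁ t z).fun_pow 2).const_mul (ζ z)).congr_deriv (by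
        simp only [Nat.reduceSub, pow_one]
        push_cast
        ring)
  · refine hasDerivAt_intervalIntegral_of_continuous
      (F := fun t z => ζ z * (2 * (G t z * g₁ (t, z))))
      (F' := fun t z => ζ z * (2 * (g₁ (t, z) ^ 2 + G t z * g₂ (t, z)))) ?_ ?_ (fun t z => ?_) t₀
    · simp only [Function.uncurry_def]
      fun_prop
    · simp only [Function.uncurry_def]
      fun_prop
    · exact ((((hd₁ t z).fun_mul (hd₂ t z)).const_mul 2).const_mul (ζ z)).congr_deriv (by ring)
  · have hcz : Continuous fun z => G t₀ z := hcG.comp (Continuous.prodMk_right t₀)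
    refine intervalIntegral.integral_mono_on hab (Continuous.intervalIntegrable (by fun_prop) _ _)
      (Continuous.intervalIntegrable (by fun_prop) _ _) fun z _ => ?_
    refine mul_le_mul_of_nonneg_left ?_ (hζ0 z)
    nlinarith [sq_nonneg (g₁ (t₀, z))]

/-- If the fibres of `w` satisfy the coercivity estimate on `[-R, R]` up to an error `ε`, then
the maximum principle bounds their weighted `L²` norms. -/
lemma weighted_energy_le {k : ℕ} {w : (Fin k → ℝ) → ℝ → ℝ} {V : ℝ → ℝ} {c ε M R : ℝ}
    (hc : 0 < c) (hR : 0 < R)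
    (hw : ContDiff ℝ 2 (fun p : (Fin k → ℝ) × ℝ => w p.1 p.2)) (hwM : ∀ y z, |w y z| ≤ M)
    (hpde : ∀ y z, lapPi (fun y' => w y' z) y + iteratedDeriv 2 (w y) z - V z * w y z = 0)
    (hcoer : ∀ y, c * ∫ z in -R..R, bump R z * w y z ^ 2 ≤
      (∫ z in -R..R, bump R z * (w y z * (V z * w y z - iteratedDeriv 2 (w y) z))) + ε)
    (y : Fin k → ℝ) : c * ∫ z in -R..R, bump R z * w y z ^ 2 ≤ ε := by
  have hcw : Continuous fun p : (Fin k → ℝ) × ℝ => w p.1 p.2 := hw.continuous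
  have hcwy : ∀ y, Continuous (w y) := fun y => hcw.comp (Continuous.prodMk_right y)
  have hcb := continuous_bump R
  have hline : ∀ y (i : Fin k),
      ContDiff ℝ 2 (fun p : ℝ × ℝ => w (Function.update y i p.1) p.2) := fun y i =>
    hw.comp (((contDiff_update 2 y i).comp contDiff_fst).prodMk contDiff_snd)
  have hcoord := fun y (i : Fin k) => exists_second_deriv_weighted_energy
    (G := fun t z => w (Function.update y i t) z) (by linarith : -R ≤ R) (hline y i) hcb (bump_nonneg R) (y i)
  choose hcont D hD hDle using hcoord
  simp only [Function.update_eq_self] at hDle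
  have hmain := mul_le_of_le_add_laplacian (h := fun y => ∫ z in -R..R, bump R z * w y z ^ 2)
    (D := D) (c := 2 * c) (ε := 2 * ε) (K := ∫ z in -R..R, bump R z * M ^ 2) (by linarith)
    (intervalIntegral.continuous_parametric_intervalIntegral_of_continuous'
      (f := fun y z => bump R z * w y z ^ 2)
      (by simp only [Function.uncurry_def]; fun_prop) _ _)
    (fun y => by
      have := hcwy y
      refine intervalIntegral.integral_mono_on (by linarith)
        (Continuous.intervalIntegrable (by fun_prop) _ _)
        (Continuous.intervalIntegrable (by fun_prop) _ _) fun z _ => ?_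
      refine mul_le_mul_of_nonneg_left ?_ (bump_nonneg R z)
      rw [← sq_abs]
      exact pow_le_pow_left₀ (abs_nonneg _) (hwM y z) 2)
    hD (fun y => by
      have := hcwy y
      have h1 : ∑ i, ∫ z in -R..R, bump R z * (2 * (w y z *
          iteratedDeriv 2 (fun t => w (Function.update y i t) z) (y i)))
          = 2 * ∫ z in -R..R, bump R z * (w y z * (V z * w y z - iteratedDeriv 2 (w y) z)) := by
        rw [← intervalIntegral.integral_finsetSum, ← intervalIntegral.integral_const_mul]
        · refine intervalIntegral.integral_congr fun z _ => ?_
          have h2 : V z * w y z - iteratedDeriv 2 (w y) z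
              = ∑ i, iteratedDeriv 2 (fun t => w (Function.update y i t) z) (y i) := by
            have := hpde y z
            rw [lapPi] at this
            linarith
          simp only [h2, Finset.mul_sum]
          exact Finset.sum_congr rfl fun i _ => by ring
        · intro i _
          have := hcont y i
          exact Continuous.intervalIntegrable (by fun_prop) _ _
      have h3 := Finset.sum_le_sum fun i (_ : i ∈ Finset.univ) => hDle y i
      rw [h1] at h3
      linarith [hcoer y]) y
  linarith

/-- A function whose weighted integrals `∫ bump R * f²` become arbitrarily small is zero. -/
lemma eq_zero_of_forall_bump_integral_le {f : ℝ → ℝ} (hf : Continuous f)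
    (h : ∀ ε : ℝ, 0 < ε → ∃ R₀ : ℝ, ∀ R, R₀ ≤ R → ∫ z in -R..R, bump R z * f z ^ 2 ≤ ε) (z : ℝ) :
    f z = 0 := by
  by_contra hz
  set r := |z| + 1 with hr
  have hr0 : 0 < r := by positivity
  have hzr := abs_le.1 (show |z| ≤ r by linarith)
  have hpos : 0 < ∫ x in -r..r, f x ^ 2 :=
    intervalIntegral.integral_pos (by linarith) (hf.pow 2).continuousOn
      (fun x _ => sq_nonneg _) ⟨z, hzr, by positivity⟩
  obtain ⟨R₀, hR₀⟩ := h ((∫ x in -r..r, f x ^ 2) / 4) (by linarith)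
  set R := max R₀ (2 * r) with hR
  have hRr : 2 * r ≤ R := le_max_right _ _
  have hR0 : 0 < R := by linarith
  have h1 := hR₀ R (le_max_left _ _)
  have hcb := continuous_bump R
  have h2 : ∫ x in -r..r, bump R x * f x ^ 2 ≤ ∫ x in -R..R, bump R x * f x ^ 2 :=
    intervalIntegral.integral_mono_interval (by linarith) (by linarith) (by linarith)
      (Eventually.of_forall fun x => mul_nonneg (bump_nonneg R x) (sq_nonneg _))
      (Continuous.intervalIntegrable (by fun_prop) _ _)
  have h3 : ∫ x in -r..r, 1 / 2 * f x ^ 2 ≤ ∫ x in -r..r, bump R x * f x ^ 2 := by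
    refine intervalIntegral.integral_mono_on (by linarith)
      (Continuous.intervalIntegrable (by fun_prop) _ _)
      (Continuous.intervalIntegrable (by fun_prop) _ _) fun x hx => ?_
    refine mul_le_mul_of_nonneg_right ?_ (sq_nonneg _)
    have h4 : x ^ 2 ≤ r ^ 2 := sq_le_sq' hx.1 hx.2
    have h5 : x ^ 2 / R ^ 2 ≤ 1 / 4 := by
      rw [div_le_iff₀ (by positivity)]
      nlinarith
    unfold bump
    nlinarith
  rw [intervalIntegral.integral_const_mul] at h3
  linarith

/-- a bounded entire solution of
`Δ_{ℝ^{n-1}} w + ∂_z² w − W''(ℍ(z)) w = 0` that is fiberwise `L²`-orthogonal to `ℍ'`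
vanishes identically. -/
theorem bounded_solution_orthogonal_to_Hprime_vanishes
    (n : ℕ) (hn : 2 ≤ n)
    (W ℍ : ℝ → ℝ)
    (hWsmooth : ContDiff ℝ (⊤ : ℕ∞) W)
    (hWnonneg : ∀ x, 0 ≤ W x)
    (hWzero : ∀ x, W x = 0 ↔ x = 1 ∨ x = -1)
    (hW'zero : deriv W 0 = 0)
    (hW''zero : iteratedDeriv 2 W 0 ≠ 0)
    (hWwell : ∀ x : ℝ, 0 < |x| → |x| < 1 → x * deriv W x < 0)
    (hWconv : ∃ κ > (0:ℝ), ∃ β ∈ Set.Ioo (0:ℝ) 1, ∀ x : ℝ, 1 - β ≤ |x| → κ ≤ iteratedDeriv 2 W x)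
    (hWsymm : ∀ x, W (-x) = W x)
    (hHsmooth : ContDiff ℝ (⊤ : ℕ∞) ℍ)
    (hHrange : ∀ t, ℍ t ∈ Set.Ioo (-1:ℝ) 1)
    (hHode : ∀ t, iteratedDeriv 2 ℍ t = deriv W (ℍ t))
    (hHzero : ℍ 0 = 0)
    (hHmono : ∀ t, 0 < deriv ℍ t)
    (hHtop : Filter.Tendsto ℍ Filter.atTop (nhds 1))
    (hHbot : Filter.Tendsto ℍ Filter.atBot (nhds (-1)))
    (w : (Fin (n - 1) → ℝ) → ℝ → ℝ)
    (hw : ContDiff ℝ 2 (fun p : (Fin (n - 1) → ℝ) × ℝ => w p.1 p.2))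
    (hwB : ∃ M : ℝ, ∀ y z, |w y z| ≤ M)
    (hpde : ∀ y z, lapPi (fun y' => w y' z) y + iteratedDeriv 2 (w y) z
        - iteratedDeriv 2 W (ℍ z) * w y z = 0)
    (horth : ∀ y, (∫ z : ℝ, w y z * deriv ℍ z) = 0) :
    ∀ y z, w y z = 0 := by
  obtain ⟨κ, hκ, β, hβ, hconv⟩ := hWconv
  obtain ⟨M, hM⟩ := hwB
  set V : ℝ → ℝ := fun z => iteratedDeriv 2 W (ℍ z) with hVdef
  have hH : ∀ t, HasDerivAt ℍ (deriv ℍ t) t := fun t =>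
    (hHsmooth.differentiable (by simp) t).hasDerivAt
  have hφ : ∀ t, HasDerivAt (deriv ℍ) (deriv W (ℍ t)) t := by
    intro t
    rw [← hHode, iteratedDeriv_succ, iteratedDeriv_one]
    exact ((hHsmooth.iterate_deriv 1).differentiable (by simp) t).hasDerivAt
  have hψ : ∀ t, HasDerivAt (fun t => deriv W (ℍ t)) (V t * deriv ℍ t) t := by
    intro t
    have h1 : HasDerivAt (deriv W) (iteratedDeriv 2 W (ℍ t)) (ℍ t) := by
      rw [iteratedDeriv_succ, iteratedDeriv_one]
      exact ((hWsmooth.iterate_deriv 1).differentiable (by simp) _).hasDerivAt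
    exact h1.comp t (hH t)
  have hcW : Continuous (iteratedDeriv 2 W) :=
    (contDiff_infty.1 hWsmooth 2).continuous_iteratedDeriv 2 le_rfl
  have hVc : Continuous V := hcW.comp hHsmooth.continuous
  obtain ⟨C, hC⟩ := (isCompact_Icc (a := (-1 : ℝ)) (b := 1)).exists_bound_of_continuousOn
    hcW.continuousOn
  have hVΛ : ∀ t, V t ≤ (|C| + 1) ^ 2 := by
    intro t
    have h1 := (le_abs_self _).trans (hC (ℍ t) ⟨(hHrange t).1.le, (hHrange t).2.le⟩)
    nlinarith [le_abs_self C, abs_nonneg C]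
  obtain ⟨r₁, hr₁⟩ := eventually_atTop.1
    (hHtop.eventually_const_le (by linarith [hβ.1] : 1 - β < 1))
  obtain ⟨r₂, hr₂⟩ := eventually_atBot.1
    (hHbot.eventually_le_const (by linarith [hβ.1] : -1 < -(1 - β)))
  have hV : ∀ t, max r₁ (-r₂) ≤ |t| → Real.sqrt κ ^ 2 ≤ V t := by
    intro t ht
    rw [Real.sq_sqrt hκ.le]
    refine hconv _ ?_
    rcases abs_choice t with h | h <;> rw [h] at ht
    · exact (hr₁ t ((le_max_left _ _).trans ht)).trans (le_abs_self _)
    · have h1 := hr₂ t (by linarith [(le_max_right r₁ (-r₂)).trans ht])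
      linarith [neg_le_abs (ℍ t)]
  obtain ⟨c, hc, hcoer⟩ := exists_bump_coercivity (Real.sqrt_pos.2 hκ) (by positivity) hHmono hH
    hφ hψ (fun t => abs_le.2 ⟨(hHrange t).1.le, (hHrange t).2.le⟩) hVc hVΛ hV hHtop hHbot
  have hwy : ∀ y, ContDiff ℝ 2 (w y) := fun y => hw.comp (contDiff_const.prodMk contDiff_id)
  have hw₂ : ∀ y, Continuous (iteratedDeriv 2 (w y)) := fun y =>
    (hwy y).continuous_iteratedDeriv 2 le_rfl
  have hd₁ : ∀ y z, HasDerivAt (w y) (deriv (w y) z) z := fun y z =>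
    ((hwy y).differentiable (by norm_num) z).hasDerivAt
  have hd₂ : ∀ y z, HasDerivAt (deriv (w y)) (iteratedDeriv 2 (w y) z) z := by
    intro y z
    rw [iteratedDeriv_succ, iteratedDeriv_one]
    have h1 : ContDiff ℝ 1 (deriv (w y)) := (contDiff_succ_iff_deriv.1 (hwy y)).2.2
    exact (h1.differentiable (by norm_num) z).hasDerivAt
  intro y
  refine eq_zero_of_forall_bump_integral_le (hwy y).continuous fun ε hε => ?_
  obtain ⟨R₀, hR₀, hbound⟩ := hcoer M (c * ε) (by positivity)
  refine ⟨R₀, fun R hR => ?_⟩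
  have := weighted_energy_le hc (hR₀.trans_le hR) hw hM hpde
    (fun y => hbound R hR (w y) _ _ (hd₁ y) (hd₂ y) (hw₂ y) (hM y) (horth y)) y
  exact le_of_mul_le_mul_left this hc
end

section
/- Let u : ℝ → ℝ be a C² function such that u, u', u'' are polynomially bounded, i.e. there are C' > 0 and m ∈ ℕ with |u(t)| + |u'(t)| + |u''(t)| ≤ C'(1 + |t|)^m for all t. Then ∫_ℝ W'''(ℍ(t)) u(t) (ℍ'(t))² dt = ∫_ℝ ℍ''(t) ( u''(t) − W''(ℍ(t)) u(t) ) dt, with both integrals absolutely convergent. -/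
open MeasureTheory Filter

lemma pow_one_add_abs_mul_exp_le {a : ℝ} (ha : 0 < a) (m : ℕ) (t : ℝ) :
    (1 + |t|) ^ m * Real.exp (-a * |t|) ≤
      ((m + 2).factorial / a ^ (m + 2) * Real.exp a) * (1 + t ^ 2)⁻¹ := by
  have hp : (a * (1 + |t|)) ^ (m + 2) / (m + 2).factorial ≤ Real.exp (a * (1 + |t|)) :=
    Real.pow_div_factorial_le_exp _ (by positivity) _
  have hfac : (0 : ℝ) < (m + 2).factorial := by positivity
  have hexp : Real.exp (a * (1 + |t|)) * Real.exp (-a * |t|) = Real.exp a := by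
    rw [← Real.exp_add]
    ring_nf
  rw [div_le_iff₀ hfac, mul_pow] at hp
  have hsq : 1 + t ^ 2 ≤ (1 + |t|) ^ 2 := by
    rw [← sq_abs t]
    nlinarith [abs_nonneg t]
  rw [← div_eq_mul_inv, le_div_iff₀ (by positivity), div_mul_eq_mul_div, le_div_iff₀ (by positivity)]
  calc (1 + |t|) ^ m * Real.exp (-a * |t|) * (1 + t ^ 2) * a ^ (m + 2)
      ≤ (1 + |t|) ^ m * Real.exp (-a * |t|) * (1 + |t|) ^ 2 * a ^ (m + 2) := by gcongr
    _ = a ^ (m + 2) * (1 + |t|) ^ (m + 2) * Real.exp (-a * |t|) := by ring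
    _ ≤ Real.exp (a * (1 + |t|)) * (m + 2).factorial * Real.exp (-a * |t|) := by gcongr
    _ = (m + 2).factorial * Real.exp a := by rw [← hexp]; ring

lemma Continuous.integrable_of_abs_le_pow_mul_exp {f : ℝ → ℝ} (hf : Continuous f) {a K : ℝ}
    (ha : 0 < a) (hK : 0 ≤ K) (m : ℕ)
    (h : ∀ t, |f t| ≤ K * ((1 + |t|) ^ m * Real.exp (-a * |t|))) : Integrable f := by
  refine ((integrable_inv_one_add_sq.const_mul
    ((m + 2).factorial / a ^ (m + 2) * Real.exp a)).const_mul K).mono'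
    hf.aestronglyMeasurable (ae_of_all _ fun t => ?_)
  exact (h t).trans (mul_le_mul_of_nonneg_left (pow_one_add_abs_mul_exp_le ha m t) hK)

lemma Continuous.exists_abs_comp_le {f g : ℝ → ℝ} (hf : Continuous f)
    (hg : ∀ t, g t ∈ Set.Ioo (-1 : ℝ) 1) : ∃ B, 0 ≤ B ∧ ∀ t, |f (g t)| ≤ B := by
  obtain ⟨B, hB⟩ := isCompact_Icc.exists_bound_of_continuousOn (s := Set.Icc (-1 : ℝ) 1)
    hf.continuousOn
  have h (t : ℝ) : |f (g t)| ≤ B := hB _ (Set.Ioo_subset_Icc_self (hg t))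
  exact ⟨B, (abs_nonneg _).trans (h 0), h⟩

lemma ContDiff.hasDerivAt_iteratedDeriv {f : ℝ → ℝ} {n : WithTop ℕ∞} (hf : ContDiff ℝ n f) (k : ℕ)
    (hk : k < n) (x : ℝ) : HasDerivAt (iteratedDeriv k f) (iteratedDeriv (k + 1) f x) x := by
  rw [iteratedDeriv_succ]
  exact (hf.differentiable_iteratedDeriv k hk x).hasDerivAt

/-- for a C² function `u` with polynomially bounded `u, u', u''`,
`∫ W'''(ℍ) u (ℍ')² = ∫ ℍ'' (u'' − W''(ℍ) u)`, both integrals being absolutely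
convergent. -/
theorem integral_Wppp_identity_polybounded
    (W ℍ : ℝ → ℝ)
    (hWsmooth : ContDiff ℝ (⊤ : ℕ∞) W)
    (hWnonneg : ∀ x, 0 ≤ W x)
    (hWzero : ∀ x, W x = 0 ↔ x = 1 ∨ x = -1)
    (hW'zero : deriv W 0 = 0)
    (hW''zero : iteratedDeriv 2 W 0 ≠ 0)
    (hWwell : ∀ x : ℝ, 0 < |x| → |x| < 1 → x * deriv W x < 0)
    (hWconv : ∃ κ > (0:ℝ), ∃ β ∈ Set.Ioo (0:ℝ) 1, ∀ x : ℝ, 1 - β ≤ |x| → κ ≤ iteratedDeriv 2 W x)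
    (hWsymm : ∀ x, W (-x) = W x)
    (hHsmooth : ContDiff ℝ (⊤ : ℕ∞) ℍ)
    (hHrange : ∀ t, ℍ t ∈ Set.Ioo (-1:ℝ) 1)
    (hHode : ∀ t, iteratedDeriv 2 ℍ t = deriv W (ℍ t))
    (hHzero : ℍ 0 = 0)
    (hHmono : ∀ t, 0 < deriv ℍ t)
    (hHtop : Filter.Tendsto ℍ Filter.atTop (nhds 1))
    (hHbot : Filter.Tendsto ℍ Filter.atBot (nhds (-1)))
    (hdecay : ∃ C > (0:ℝ), ∃ a > (0:ℝ), ∀ t : ℝ,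
      |deriv ℍ t| + |iteratedDeriv 2 ℍ t| ≤ C * Real.exp (-a * |t|))
    (u : ℝ → ℝ) (hu : ContDiff ℝ 2 u)
    (hupoly : ∃ C' > (0:ℝ), ∃ m : ℕ, ∀ t : ℝ,
      |u t| + |deriv u t| + |iteratedDeriv 2 u t| ≤ C' * (1 + |t|) ^ m) :
    Integrable (fun t : ℝ => iteratedDeriv 3 W (ℍ t) * u t * (deriv ℍ t) ^ 2) ∧
    Integrable (fun t : ℝ =>
      iteratedDeriv 2 ℍ t * (iteratedDeriv 2 u t - iteratedDeriv 2 W (ℍ t) * u t)) ∧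
    (∫ t : ℝ, iteratedDeriv 3 W (ℍ t) * u t * (deriv ℍ t) ^ 2) =
      ∫ t : ℝ, iteratedDeriv 2 ℍ t * (iteratedDeriv 2 u t - iteratedDeriv 2 W (ℍ t) * u t) := by
  have lt_top (k : ℕ) : (k : WithTop ℕ∞) < ((⊤ : ℕ∞) : WithTop ℕ∞) := by
    exact_mod_cast ENat.natCast_lt_top k
  have hH0 (t : ℝ) : HasDerivAt ℍ (deriv ℍ t) t := by
    simpa using hHsmooth.hasDerivAt_iteratedDeriv 0 (lt_top 0) t
  have hH1 (t : ℝ) : HasDerivAt (deriv ℍ) (iteratedDeriv 2 ℍ t) t := by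
    simpa using hHsmooth.hasDerivAt_iteratedDeriv 1 (lt_top 1) t
  have hW1 (x : ℝ) : HasDerivAt (deriv W) (iteratedDeriv 2 W x) x := by
    simpa using hWsmooth.hasDerivAt_iteratedDeriv 1 (lt_top 1) x
  have hW2 (x : ℝ) : HasDerivAt (iteratedDeriv 2 W) (iteratedDeriv 3 W x) x :=
    hWsmooth.hasDerivAt_iteratedDeriv 2 (lt_top 2) x
  have hu0 (t : ℝ) : HasDerivAt u (deriv u t) t := by
    simpa using hu.hasDerivAt_iteratedDeriv 0 (by norm_num) t
  have hu1 (t : ℝ) : HasDerivAt (deriv u) (iteratedDeriv 2 u t) t := by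
    simpa using hu.hasDerivAt_iteratedDeriv 1 (by norm_num) t
  have hH2 (t : ℝ) : HasDerivAt (iteratedDeriv 2 ℍ) (iteratedDeriv 2 W (ℍ t) * deriv ℍ t) t := by
    rw [show iteratedDeriv 2 ℍ = deriv W ∘ ℍ from funext hHode]
    exact (hW1 (ℍ t)).comp t (hH0 t)
  have hF (t : ℝ) : HasDerivAt
      (fun t => u t * (iteratedDeriv 2 W (ℍ t) * deriv ℍ t) - iteratedDeriv 2 ℍ t * deriv u t)
      (iteratedDeriv 3 W (ℍ t) * u t * (deriv ℍ t) ^ 2 -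
        iteratedDeriv 2 ℍ t * (iteratedDeriv 2 u t - iteratedDeriv 2 W (ℍ t) * u t)) t := by
    refine (((hu0 t).mul (((hW2 (ℍ t)).comp t (hH0 t)).mul (hH1 t))).sub
      ((hH2 t).mul (hu1 t))).congr_deriv ?_
    simp only [Function.comp_apply, Pi.mul_apply]
    ring
  have cH : Continuous ℍ := hHsmooth.continuous
  have cH1 : Continuous (deriv ℍ) := continuous_iff_continuousAt.2 fun t => (hH1 t).continuousAt
  have cH2 : Continuous (iteratedDeriv 2 ℍ) :=
    continuous_iff_continuousAt.2 fun t => (hH2 t).continuousAt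
  have cW2 : Continuous (iteratedDeriv 2 W) := hWsmooth.continuous_iteratedDeriv 2 (lt_top 2).le
  have cW3 : Continuous (iteratedDeriv 3 W) := hWsmooth.continuous_iteratedDeriv 3 (lt_top 3).le
  have cu : Continuous u := hu.continuous
  have cu1 : Continuous (deriv u) := continuous_iff_continuousAt.2 fun t => (hu1 t).continuousAt
  have cu2 : Continuous (iteratedDeriv 2 u) := hu.continuous_iteratedDeriv 2 le_rfl
  obtain ⟨B₂, hB₂0, hB₂⟩ := cW2.exists_abs_comp_le hHrange
  obtain ⟨B₃, hB₃0, hB₃⟩ := cW3.exists_abs_comp_le hHrange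
  obtain ⟨C, hC, a, ha, hdec⟩ := hdecay
  obtain ⟨D, hD, m, hpoly⟩ := hupoly
  have hv (t : ℝ) : |deriv ℍ t| ≤ C * Real.exp (-a * |t|) :=
    (le_add_of_nonneg_right (abs_nonneg _)).trans (hdec t)
  have hw (t : ℝ) : |iteratedDeriv 2 ℍ t| ≤ C * Real.exp (-a * |t|) :=
    (le_add_of_nonneg_left (abs_nonneg _)).trans (hdec t)
  have hvC (t : ℝ) : |deriv ℍ t| ≤ C := by
    refine (hv t).trans (mul_le_of_le_one_right hC.le (Real.exp_le_one_iff.2 ?_))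
    nlinarith [abs_nonneg t]
  have hu0b (t : ℝ) : |u t| ≤ D * (1 + |t|) ^ m := by
    linarith [hpoly t, abs_nonneg (deriv u t), abs_nonneg (iteratedDeriv 2 u t)]
  have hu1b (t : ℝ) : |deriv u t| ≤ D * (1 + |t|) ^ m := by
    linarith [hpoly t, abs_nonneg (u t), abs_nonneg (iteratedDeriv 2 u t)]
  have hu2b (t : ℝ) : |iteratedDeriv 2 u t| ≤ D * (1 + |t|) ^ m := by
    linarith [hpoly t, abs_nonneg (u t), abs_nonneg (deriv u t)]
  have hleft : Integrable fun t : ℝ => iteratedDeriv 3 W (ℍ t) * u t * (deriv ℍ t) ^ 2 := by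
    refine Continuous.integrable_of_abs_le_pow_mul_exp (by fun_prop) ha
      (K := B₃ * D * C * C) (by positivity) m fun t => ?_
    rw [abs_mul, abs_mul, abs_pow, sq]
    calc |iteratedDeriv 3 W (ℍ t)| * |u t| * (|deriv ℍ t| * |deriv ℍ t|)
        ≤ B₃ * (D * (1 + |t|) ^ m) * (C * (C * Real.exp (-a * |t|))) := by
          gcongr
          exacts [hB₃ t, hu0b t, hvC t, hv t]
      _ = _ := by ring
  have hright : Integrable fun t : ℝ =>
      iteratedDeriv 2 ℍ t * (iteratedDeriv 2 u t - iteratedDeriv 2 W (ℍ t) * u t) := by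
    refine Continuous.integrable_of_abs_le_pow_mul_exp (by fun_prop) ha
      (K := C * (1 + B₂) * D) (by positivity) m fun t => ?_
    rw [abs_mul]
    calc |iteratedDeriv 2 ℍ t| * |iteratedDeriv 2 u t - iteratedDeriv 2 W (ℍ t) * u t|
        ≤ |iteratedDeriv 2 ℍ t| * (|iteratedDeriv 2 u t| + |iteratedDeriv 2 W (ℍ t)| * |u t|) := by
          rw [← abs_mul (iteratedDeriv 2 W (ℍ t))]
          gcongr
          exact abs_sub _ _
      _ ≤ (C * Real.exp (-a * |t|)) * (D * (1 + |t|) ^ m + B₂ * (D * (1 + |t|) ^ m)) := by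
          gcongr
          exacts [hw t, hu2b t, hB₂ t, hu0b t]
      _ = _ := by ring
  have hprim : Integrable fun t : ℝ =>
      u t * (iteratedDeriv 2 W (ℍ t) * deriv ℍ t) - iteratedDeriv 2 ℍ t * deriv u t := by
    refine Continuous.integrable_of_abs_le_pow_mul_exp (by fun_prop) ha
      (K := C * (1 + B₂) * D) (by positivity) m fun t => ?_
    calc |u t * (iteratedDeriv 2 W (ℍ t) * deriv ℍ t) - iteratedDeriv 2 ℍ t * deriv u t|
        ≤ |u t| * (|iteratedDeriv 2 W (ℍ t)| * |deriv ℍ t|)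
            + |iteratedDeriv 2 ℍ t| * |deriv u t| := by
          simp only [← abs_mul]
          exact abs_sub _ _
      _ ≤ (D * (1 + |t|) ^ m) * (B₂ * (C * Real.exp (-a * |t|)))
            + (C * Real.exp (-a * |t|)) * (D * (1 + |t|) ^ m) := by
          gcongr
          exacts [hu0b t, hB₂ t, hv t, hw t, hu1b t]
      _ = _ := by ring
  refine ⟨hleft, hright, sub_eq_zero.1 ?_⟩
  rw [← integral_sub hleft hright]
  exact integral_eq_zero_of_hasDerivAt_of_integrable hF (hleft.sub hright) hprim
end

section
/- Let 𝕁 : ℝ → ℝ be a C² function such that 𝕁, 𝕁', 𝕁'' are polynomially bounded and 𝕁''(t) − W''(ℍ(t)) 𝕁(t) = t ℍ'(t) for all t. Then ∫_ℝ W'''(ℍ(t)) 𝕁(t) (ℍ'(t))² dt = −(1/2) 𝔢₀. -/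
open MeasureTheory Filter

lemma exists_one_add_pow_mul_exp_le (m : ℕ) {b : ℝ} (hb : 0 < b) :
    ∃ K : ℝ, 0 ≤ K ∧ ∀ x : ℝ, 0 ≤ x → (1 + x) ^ m * Real.exp (-b * x) ≤ K := by
  refine ⟨m.factorial / b ^ m * Real.exp b, by positivity, fun x hx => ?_⟩
  have h := Real.pow_div_factorial_le_exp (x := b * (1 + x)) (by positivity) m
  rw [mul_add, mul_one, Real.exp_add, div_le_iff₀ (by positivity)] at h
  have h2 : (b * (1 + x)) ^ m * Real.exp (-b * x) ≤ m.factorial * Real.exp b := by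
    calc (b * (1 + x)) ^ m * Real.exp (-b * x)
        ≤ (Real.exp b * Real.exp (b * x) * m.factorial) * Real.exp (-b * x) := by
          gcongr
          simpa [mul_add] using h
      _ = m.factorial * Real.exp b * (Real.exp (b * x) * Real.exp (-b * x)) := by ring
      _ = m.factorial * Real.exp b := by rw [← Real.exp_add]; simp
  rw [div_mul_eq_mul_div, le_div_iff₀ (by positivity)]
  calc (1 + x) ^ m * Real.exp (-b * x) * b ^ m = (b * (1 + x)) ^ m * Real.exp (-b * x) := by
        rw [mul_pow]; ring
    _ ≤ _ := h2

lemma integrable_exp_neg_mul_abs {b : ℝ} (hb : 0 < b) :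
    Integrable fun t : ℝ => Real.exp (-b * |t|) := by
  rw [← integrableOn_univ, ← Set.Iic_union_Ioi (a := (0 : ℝ))]
  refine IntegrableOn.union ?_ ?_
  · refine (integrableOn_exp_mul_Iic hb 0).congr_fun (fun t ht => ?_) measurableSet_Iic
    simp [abs_of_nonpos (Set.mem_Iic.mp ht)]
  · refine (integrableOn_exp_mul_Ioi (neg_neg_of_pos hb) 0).congr_fun (fun t ht => ?_)
      measurableSet_Ioi
    simp [abs_of_pos (Set.mem_Ioi.mp ht)]

lemma Continuous.integrable_of_abs_le_exp {f : ℝ → ℝ} (hf : Continuous f) {K b : ℝ} (hb : 0 < b)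
    (h : ∀ t, |f t| ≤ K * Real.exp (-b * |t|)) : Integrable f :=
  ((integrable_exp_neg_mul_abs hb).const_mul K).mono' hf.aestronglyMeasurable
    (Eventually.of_forall h)

lemma tendsto_zero_of_abs_le_exp {f : ℝ → ℝ} {K b : ℝ} (hb : 0 < b)
    (h : ∀ t, |f t| ≤ K * Real.exp (-b * |t|)) {l : Filter ℝ}
    (hl : Tendsto (fun t : ℝ => |t|) l atTop) : Tendsto f l (nhds 0) := by
  refine squeeze_zero_norm h ?_
  have := (Real.tendsto_exp_atBot.comp (hl.const_mul_atTop_of_neg (neg_neg_of_pos hb))).const_mul K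
  simpa using this

lemma exists_abs_comp_le_of_mem_Ioo {f u : ℝ → ℝ} {p q : ℝ} (hf : Continuous f)
    (hu : ∀ t, u t ∈ Set.Ioo p q) : ∃ B, ∀ t, |f (u t)| ≤ B := by
  obtain ⟨B, hB⟩ := isCompact_Icc.exists_bound_of_continuousOn (s := Set.Icc p q) hf.continuousOn
  exact ⟨B, fun t => hB _ (Set.Ioo_subset_Icc_self (hu t))⟩

lemma hasDerivAt_linearized_antiderivative {W H J : ℝ → ℝ} (hW : ContDiff ℝ (⊤ : ℕ∞) W)
    (hH : ContDiff ℝ (⊤ : ℕ∞) H) (hJ : ContDiff ℝ 2 J)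
    (hHode : ∀ t, iteratedDeriv 2 H t = deriv W (H t))
    (hJode : ∀ t, iteratedDeriv 2 J t - iteratedDeriv 2 W (H t) * J t = t * deriv H t) (t : ℝ) :
    HasDerivAt
      (fun t => 1 / 2 * (t * deriv H t ^ 2) - deriv J t * iteratedDeriv 2 H t
        + iteratedDeriv 2 W (H t) * J t * deriv H t)
      (iteratedDeriv 3 W (H t) * J t * deriv H t ^ 2 + 1 / 2 * deriv H t ^ 2) t := by
  have hlt (n : ℕ) : (n : WithTop ℕ∞) < ((⊤ : ℕ∞) : WithTop ℕ∞) := by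
    exact_mod_cast ENat.natCast_lt_top n
  have dH0 : HasDerivAt H (deriv H t) t := (hH.differentiable (by simp) t).hasDerivAt
  have dH1 : HasDerivAt (deriv H) (iteratedDeriv 2 H t) t := by
    have := (hH.differentiable_iteratedDeriv 1 (hlt 1) t).hasDerivAt
    rwa [← iteratedDeriv_succ, iteratedDeriv_one] at this
  have dW1 : HasDerivAt (deriv W) (iteratedDeriv 2 W (H t)) (H t) := by
    have := (hW.differentiable_iteratedDeriv 1 (hlt 1) (H t)).hasDerivAt
    rwa [← iteratedDeriv_succ, iteratedDeriv_one] at this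
  have dW2 : HasDerivAt (iteratedDeriv 2 W) (iteratedDeriv 3 W (H t)) (H t) := by
    have := (hW.differentiable_iteratedDeriv 2 (hlt 2) (H t)).hasDerivAt
    rwa [← iteratedDeriv_succ] at this
  have dH2 : HasDerivAt (iteratedDeriv 2 H) (iteratedDeriv 2 W (H t) * deriv H t) t := by
    rw [funext hHode]
    exact dW1.comp t dH0
  have dJ0 : HasDerivAt J (deriv J t) t := (hJ.differentiable (by simp) t).hasDerivAt
  have dJ1 : HasDerivAt (deriv J) (iteratedDeriv 2 J t) t := by
    have := (hJ.differentiable_iteratedDeriv 1 (by norm_num) t).hasDerivAt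
    rwa [← iteratedDeriv_succ, iteratedDeriv_one] at this
  have key := ((((hasDerivAt_id t).mul (dH1.pow 2)).const_mul (1 / 2)).sub (dJ1.mul dH2)).add
    (((dW2.comp t dH0).mul dJ0).mul dH1)
  refine key.congr_deriv ?_
  simp only [id, Function.comp, Pi.mul_apply, Pi.pow_apply]
  push_cast
  linear_combination (-iteratedDeriv 2 H t) * hJode t

/-- if `𝕁'' − W''(ℍ)𝕁 = t ℍ'` with `𝕁, 𝕁', 𝕁''` polynomially bounded, then
`∫ W'''(ℍ) 𝕁 (ℍ')² = −(1/2)𝔢₀`. -/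
theorem integral_Wppp_J_eq_neg_half_e0
    (W ℍ : ℝ → ℝ)
    (hWsmooth : ContDiff ℝ (⊤ : ℕ∞) W)
    (hWnonneg : ∀ x, 0 ≤ W x)
    (hWzero : ∀ x, W x = 0 ↔ x = 1 ∨ x = -1)
    (hW'zero : deriv W 0 = 0)
    (hW''zero : iteratedDeriv 2 W 0 ≠ 0)
    (hWwell : ∀ x : ℝ, 0 < |x| → |x| < 1 → x * deriv W x < 0)
    (hWconv : ∃ κ > (0:ℝ), ∃ β ∈ Set.Ioo (0:ℝ) 1, ∀ x : ℝ, 1 - β ≤ |x| → κ ≤ iteratedDeriv 2 W x)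
    (hWsymm : ∀ x, W (-x) = W x)
    (hHsmooth : ContDiff ℝ (⊤ : ℕ∞) ℍ)
    (hHrange : ∀ t, ℍ t ∈ Set.Ioo (-1:ℝ) 1)
    (hHode : ∀ t, iteratedDeriv 2 ℍ t = deriv W (ℍ t))
    (hHzero : ℍ 0 = 0)
    (hHmono : ∀ t, 0 < deriv ℍ t)
    (hHtop : Filter.Tendsto ℍ Filter.atTop (nhds 1))
    (hHbot : Filter.Tendsto ℍ Filter.atBot (nhds (-1)))
    (hdecay : ∃ C > (0:ℝ), ∃ a > (0:ℝ), ∀ t : ℝ,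
      |deriv ℍ t| + |iteratedDeriv 2 ℍ t| ≤ C * Real.exp (-a * |t|))
    (𝕁 : ℝ → ℝ) (hJ : ContDiff ℝ 2 𝕁)
    (hJpoly : ∃ C' > (0:ℝ), ∃ m : ℕ, ∀ t : ℝ,
      |𝕁 t| + |deriv 𝕁 t| + |iteratedDeriv 2 𝕁 t| ≤ C' * (1 + |t|) ^ m)
    (hJode : ∀ t : ℝ, iteratedDeriv 2 𝕁 t - iteratedDeriv 2 W (ℍ t) * 𝕁 t = t * deriv ℍ t) :
    (∫ t : ℝ, iteratedDeriv 3 W (ℍ t) * 𝕁 t * (deriv ℍ t) ^ 2)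
      = -(1/2) * ∫ t : ℝ, (deriv ℍ t) ^ 2 := by
  obtain ⟨C, hC, a, ha, hdec⟩ := hdecay
  obtain ⟨C', hC', m, hJb⟩ := hJpoly
  have hb : 0 < a / 2 := half_pos ha
  obtain ⟨K, hK, hKb⟩ := exists_one_add_pow_mul_exp_le m hb
  obtain ⟨L, hL, hLb⟩ := exists_one_add_pow_mul_exp_le 1 hb
  obtain ⟨B, hB⟩ := exists_abs_comp_le_of_mem_Ioo
    ((contDiff_infty.1 hWsmooth 2).continuous_iteratedDeriv' 2) hHrange
  obtain ⟨D, hD⟩ := exists_abs_comp_le_of_mem_Ioo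
    ((contDiff_infty.1 hWsmooth 3).continuous_iteratedDeriv' 3) hHrange
  have hB0 : 0 ≤ B := (abs_nonneg _).trans (hB 0)
  have hD0 : 0 ≤ D := (abs_nonneg _).trans (hD 0)
  set x : ℝ → ℝ := fun t => Real.exp (-(a / 2) * |t|) with hx
  have x0 (t : ℝ) : 0 < x t := Real.exp_pos _
  have x1 (t : ℝ) : x t ≤ 1 := Real.exp_le_one_iff.2 (by nlinarith [abs_nonneg t])
  have hsq (t : ℝ) : Real.exp (-a * |t|) = x t ^ 2 := by
    rw [hx, ← Real.exp_nat_mul]; congr 1; push_cast; ring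
  have bH (t : ℝ) : |deriv ℍ t| ≤ C * x t ^ 2 := by
    have := hdec t; rw [hsq] at this; linarith [abs_nonneg (iteratedDeriv 2 ℍ t)]
  have bH2 (t : ℝ) : |iteratedDeriv 2 ℍ t| ≤ C * x t ^ 2 := by
    have := hdec t; rw [hsq] at this; linarith [abs_nonneg (deriv ℍ t)]
  have bJs (t : ℝ) : (|𝕁 t| + |deriv 𝕁 t|) * x t ≤ C' * K := by
    calc (|𝕁 t| + |deriv 𝕁 t|) * x t ≤ (C' * (1 + |t|) ^ m) * x t := by
          have := x0 t
          gcongr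
          linarith [hJb t, abs_nonneg (iteratedDeriv 2 𝕁 t)]
      _ = C' * ((1 + |t|) ^ m * x t) := by ring
      _ ≤ C' * K := by gcongr; exact hKb _ (abs_nonneg t)
  set M := C' * K
  have hM : 0 ≤ M := by positivity
  have bJ (t : ℝ) : |𝕁 t| * x t ≤ M := by
    nlinarith [bJs t, abs_nonneg (deriv 𝕁 t), x0 t]
  have bJ1 (t : ℝ) : |deriv 𝕁 t| * x t ≤ M := by
    nlinarith [bJs t, abs_nonneg (𝕁 t), x0 t]
  have bt (t : ℝ) : |t| * x t ≤ L := by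
    have := hLb |t| (abs_nonneg t); rw [pow_one] at this; nlinarith [x0 t]
  have cH : Continuous (deriv ℍ) := hHsmooth.continuous_deriv (by exact_mod_cast le_top)
  have xpow (t : ℝ) {n : ℕ} (hn : n ≠ 0) : x t ^ n ≤ x t := pow_le_of_le_one (x0 t).le (x1 t) hn
  have bH' (t : ℝ) : |deriv ℍ t| ^ 2 ≤ C ^ 2 * x t ^ 4 := by
    calc |deriv ℍ t| ^ 2 ≤ (C * x t ^ 2) ^ 2 := by gcongr; exact bH t
      _ = _ := by ring
  have iE : Integrable fun t => deriv ℍ t ^ 2 := by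
    refine (cH.pow 2).integrable_of_abs_le_exp (K := C ^ 2) hb fun t => ?_
    rw [Pi.pow_apply, abs_pow]
    exact (bH' t).trans (by gcongr; exact xpow t (by norm_num))
  have iI : Integrable fun t => iteratedDeriv 3 W (ℍ t) * 𝕁 t * deriv ℍ t ^ 2 := by
    refine Continuous.integrable_of_abs_le_exp (K := D * M * C ^ 2) ?_ hb fun t => ?_
    · exact (((((contDiff_infty.1 hWsmooth 3).continuous_iteratedDeriv' 3).comp
        hHsmooth.continuous).mul hJ.continuous).mul (cH.pow 2))
    · rw [abs_mul, abs_mul, abs_pow]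
      calc _ ≤ D * |𝕁 t| * (C ^ 2 * x t ^ 4) := by gcongr; exacts [hD t, bH' t]
        _ = D * (|𝕁 t| * x t) * C ^ 2 * x t ^ 3 := by ring
        _ ≤ D * M * C ^ 2 * x t := by
          have := x0 t
          gcongr; exacts [bJ t, xpow t (by norm_num)]
  have bF (t : ℝ) : |1 / 2 * (t * deriv ℍ t ^ 2) - deriv 𝕁 t * iteratedDeriv 2 ℍ t
        + iteratedDeriv 2 W (ℍ t) * 𝕁 t * deriv ℍ t|
      ≤ (1 / 2 * (L * C ^ 2) + M * C + B * M * C) * x t := by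
    have := x0 t
    have e1 : |1 / 2 * (t * deriv ℍ t ^ 2)| ≤ 1 / 2 * (L * C ^ 2) * x t := by
      rw [abs_mul, abs_mul, abs_pow, abs_of_pos (by norm_num : (0 : ℝ) < 1 / 2)]
      calc _ ≤ 1 / 2 * (|t| * (C ^ 2 * x t ^ 4)) := by gcongr; exact bH' t
        _ = 1 / 2 * ((|t| * x t) * C ^ 2) * x t ^ 3 := by ring
        _ ≤ _ := by gcongr; exacts [bt t, xpow t (by norm_num)]
    have e2 : |deriv 𝕁 t * iteratedDeriv 2 ℍ t| ≤ M * C * x t := by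
      rw [abs_mul]
      calc _ ≤ |deriv 𝕁 t| * (C * x t ^ 2) := by gcongr; exact bH2 t
        _ = (|deriv 𝕁 t| * x t) * C * x t := by ring
        _ ≤ _ := by gcongr; exact bJ1 t
    have e3 : |iteratedDeriv 2 W (ℍ t) * 𝕁 t * deriv ℍ t| ≤ B * M * C * x t := by
      rw [abs_mul, abs_mul]
      calc _ ≤ B * |𝕁 t| * (C * x t ^ 2) := by gcongr; exacts [hB t, bH t]
        _ = B * (|𝕁 t| * x t) * C * x t := by ring
        _ ≤ _ := by gcongr; exact bJ t
    refine (abs_add_le _ _).trans ?_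
    linarith [abs_sub (1 / 2 * (t * deriv ℍ t ^ 2)) (deriv 𝕁 t * iteratedDeriv 2 ℍ t)]
  have hint := integral_of_hasDerivAt_of_tendsto
    (hasDerivAt_linearized_antiderivative hWsmooth hHsmooth hJ hHode hJode)
    (iI.add (iE.const_mul (1 / 2)))
    (tendsto_zero_of_abs_le_exp hb bF tendsto_abs_atBot_atTop)
    (tendsto_zero_of_abs_le_exp hb bF tendsto_abs_atTop_atTop)
  rw [integral_add iI (iE.const_mul (1 / 2)), integral_const_mul] at hint
  linarith
end
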